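/- arXiv:math/0004189 — 7 statements merged into one kernel-verified Lean document; each statement's English description precedes it below -/
import Mathlib

section
/- Let p and q be twin primes with q - p = 2, suppose p ≡ 3 (mod 8), and suppose there exist integers a, b, c and signs ε, δ ∈ {+1, -1} such that q = a² + b² and (a + ε)² + (b + δ)² = c². Let E₊ be the elliptic curve y² = x(x + p)(x + q). Then the Mordell–Weil group E₊(ℚ) is isomorphic as an abelian group to (ℤ/2ℤ) ⊕ (ℤ/2ℤ) ⊕ ℤ; in particular rank E₊(ℚ) = 1. -/
/-- The elliptic curve `E₊ : y² = x (x + p) (x + q)` as a Weierstrass curve over `ℚ`. -/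
def twinCurvePlus (p q : ℤ) : WeierstrassCurve ℚ :=
  ⟨0, (p : ℚ) + (q : ℚ), 0, (p : ℚ) * (q : ℚ), 0⟩

namespace WeierstrassCurve.Affine.Point

open Height

section ParallelogramLaw

variable {K : Type*} [Field K] [DecidableEq K] {W : Affine K}

/-- The projective identity behind the parallelogram law, for a point and itself. -/
lemma exists_smul_sym2x_add_self [W.IsElliptic] (P : W.Point) :
    ∃ c : K, c ≠ 0 ∧ (P + P).sym2x (P - P) =
      c • fun i ↦ (addSubMap W i).eval (P.sym2x P) := by
  rcases P with _ | ⟨x, y, h⟩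
  · refine ⟨1, one_ne_zero, ?_⟩
    rw [← zero_def]
    ext i
    fin_cases i <;> simp [addSubMap, -addX, -negY]
  have hE := (W.equation_iff x y).mp h.1
  have hD : (y - W.negY x y) ^ 2 = 4 * x ^ 3 + W.b₂ * x ^ 2 + 2 * W.b₄ * x + W.b₆ := by
    simp only [negY, b₂, b₄, b₆]
    linear_combination 4 * hE
  by_cases hy : y = W.negY x y
  · rw [add_self_of_Y_eq hy, sub_self, sym2x_zero_zero, sym2x_some_some]
    have hne := addSubMap_ne_zero W (x := ![x * x, x + x, 1]) (by simp)
    have hv : (fun i ↦ (addSubMap W i).eval ![x * x, x + x, 1]) =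
        ![(addSubMap W 0).eval ![x * x, x + x, 1], 0, 0] := by
      rw [← hy, sub_self] at hD
      ext i
      fin_cases i
      · rfl
      · simp [addSubMap, -addX, -negY]
        linear_combination -hD
      · simp [addSubMap, -addX, -negY]
        ring
    rw [hv] at hne ⊢
    set t := (addSubMap W 0).eval ![x * x, x + x, 1]
    have ht : t ≠ 0 := by
      rintro h0
      simp [h0] at hne
    refine ⟨t⁻¹, inv_ne_zero ht, ?_⟩
    ext i
    fin_cases i <;> simp [ht]
  · have hy' : y - W.negY x y ≠ 0 := sub_ne_zero.mpr hy
    rw [add_self_of_Y_ne hy, sub_self, sym2x_some_zero, sym2x_some_some]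
    refine ⟨((y - W.negY x y) ^ 2)⁻¹, inv_ne_zero (pow_ne_zero 2 hy'), ?_⟩
    have hX : W.addX x x (W.slope x x y y) * (y - W.negY x y) ^ 2 =
        x ^ 4 - W.b₄ * x ^ 2 - 2 * W.b₆ * x - W.b₈ := by
      rw [slope_of_Y_ne rfl hy, addX]
      field_simp
      simp only [negY, b₄, b₆, b₈]
      linear_combination -(W.a₁ ^ 2 + 4 * W.a₂ + 8 * x) * hE
    ext i
    fin_cases i
    · simp [addSubMap, -addX, -negY]
      rw [eq_inv_mul_iff_mul_eq₀ (pow_ne_zero 2 hy')]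
      linear_combination hX
    · simp [addSubMap, -addX, -negY]
      rw [eq_inv_mul_iff_mul_eq₀ (pow_ne_zero 2 hy')]
      linear_combination hD
    · simp [addSubMap, -addX, -negY]
      right
      ring

lemma exists_smul_sym2x_add_sub [W.IsElliptic] (P Q : W.Point) :
    ∃ c : K, c ≠ 0 ∧ (P + Q).sym2x (P - Q) =
      c • fun i ↦ (addSubMap W i).eval (P.sym2x Q) := by
  rcases P with _ | ⟨x₁, y₁, h₁⟩
  · refine ⟨1, one_ne_zero, ?_⟩
    rw [← zero_def, zero_add, zero_sub, sym2x_neg_right]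
    rcases Q with _ | ⟨x₂, y₂, h₂⟩
    · rw [← zero_def]
      ext i
      fin_cases i <;> simp [addSubMap, -addX, -negY]
    · rw [sym2x_zero_some, sym2x_some_some]
      ext i
      fin_cases i <;> simp [addSubMap] <;> ring
  rcases Q with _ | ⟨x₂, y₂, h₂⟩
  · refine ⟨1, one_ne_zero, ?_⟩
    rw [← zero_def, add_zero, sub_zero, sym2x_some_zero, sym2x_some_some]
    ext i
    fin_cases i <;> simp [addSubMap] <;> ring
  by_cases hx : x₁ = x₂
  · obtain hPQ | hPQ := X_eq_iff (h₁ := h₁) (h₂ := h₂) |>.mp hx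
    · rw [← hPQ]
      exact exists_smul_sym2x_add_self _
    · rw [← neg_eq_iff_eq_neg.mpr hPQ, sym2x_neg_right, ← sub_eq_add_neg, sub_neg_eq_add, sym2x_comm]
      exact exists_smul_sym2x_add_self _
  · have hx' : x₁ - x₂ ≠ 0 := sub_ne_zero.mpr hx
    have hE₁ := (W.equation_iff x₁ y₁).mp h₁.1
    have hE₂ := (W.equation_iff x₂ y₂).mp h₂.1
    rw [sub_eq_add_neg, neg_some, add_of_X_ne hx, add_of_X_ne hx, sym2x_some_some, sym2x_some_some]
    refine ⟨((x₁ - x₂) ^ 2)⁻¹, inv_ne_zero (pow_ne_zero 2 hx'), ?_⟩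
    have huv : (y₁ - y₂) * (y₁ - W.negY x₂ y₂) = (x₁ - x₂) *
        (x₁ ^ 2 + x₁ * x₂ + x₂ ^ 2 + W.a₂ * (x₁ + x₂) + W.a₄ - W.a₁ * y₁) := by
      simp only [negY]
      linear_combination hE₁ - hE₂
    have hmul : W.addX x₁ x₂ (W.slope x₁ x₂ y₁ y₂) *
        W.addX x₁ x₂ (W.slope x₁ x₂ y₁ (W.negY x₂ y₂)) * (x₁ - x₂) ^ 2 =
        (x₁ * x₂) ^ 2 - W.b₄ * (x₁ * x₂) - W.b₆ * (x₁ + x₂) - W.b₈ := by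
      rw [slope_of_X_ne hx, slope_of_X_ne hx, addX, addX]
      field_simp
      simp only [negY, b₄, b₆, b₈] at huv ⊢
      linear_combination ((y₁ - y₂) * (y₁ - (-y₂ - W.a₁ * x₂ - W.a₃)) + (x₁ - x₂) *
        (x₁ ^ 2 + x₁ * x₂ + x₂ ^ 2 + W.a₂ * (x₁ + x₂) + W.a₄ - W.a₁ * y₁) +
        W.a₁ * (x₁ - x₂) * (2 * y₁ + W.a₁ * x₂ + W.a₃) +
        2 * (W.a₂ + x₁ + x₂) * (x₁ - x₂) ^ 2 + W.a₁ ^ 2 * (x₁ - x₂) ^ 2) * huv -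
        (W.a₁ ^ 2 + 4 * (W.a₂ + x₁ + x₂)) * (x₁ - x₂) ^ 2 * hE₁
    have hadd : (W.addX x₁ x₂ (W.slope x₁ x₂ y₁ y₂) +
        W.addX x₁ x₂ (W.slope x₁ x₂ y₁ (W.negY x₂ y₂))) * (x₁ - x₂) ^ 2 =
        2 * (x₁ + x₂) * (x₁ * x₂) + W.b₂ * (x₁ * x₂) + W.b₄ * (x₁ + x₂) + W.b₆ := by
      rw [slope_of_X_ne hx, slope_of_X_ne hx, addX, addX]
      field_simp
      simp only [negY, b₂, b₄, b₆] at huv ⊢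
      linear_combination -2 * huv + 4 * hE₁
    ext i
    fin_cases i
    · simp [addSubMap, -addX, -negY]
      rw [eq_inv_mul_iff_mul_eq₀ (pow_ne_zero 2 hx')]
      linear_combination hmul
    · simp [addSubMap, -addX, -negY]
      rw [eq_inv_mul_iff_mul_eq₀ (pow_ne_zero 2 hx')]
      linear_combination hadd
    · simp [addSubMap, -addX, -negY]
      rw [eq_inv_mul_iff_mul_eq₀ (pow_ne_zero 2 hx')]
      ring

end ParallelogramLaw

section NaiveHeight

variable {K : Type*} [Field K] [AdmissibleAbsValues K] {W : Affine K}

/-- The naïve logarithmic height of a point: the height of its `x`-coordinate in `ℙ¹`. -/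
noncomputable def naiveHeight (P : W.Point) : ℝ :=
  logHeight P.xRep

lemma naiveHeight_nonneg (P : W.Point) : 0 ≤ P.naiveHeight :=
  logHeight_nonneg _

lemma abs_logHeight_sym2x_sub_le :
    ∃ C, ∀ P Q : W.Point, |logHeight (P.sym2x Q) - (P.naiveHeight + Q.naiveHeight)| ≤ C := by
  obtain ⟨C, hC⟩ := abs_logHeight_sym2_sub_le K
  have eta (P : W.Point) : ![P.xRep 0, P.xRep 1] = P.xRep := by
    ext i
    fin_cases i <;> rfl
  refine ⟨C, fun P Q ↦ ?_⟩
  have := hC (a := P.xRep 0) (b := P.xRep 1) (c := Q.xRep 0) (d := Q.xRep 1)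
    (by rw [eta]; exact P.xRep_ne_zero) (by rw [eta]; exact Q.xRep_ne_zero)
  rwa [eta, eta] at this

/-- The approximate parallelogram law for the naïve height. -/
theorem abs_naiveHeight_add_add_naiveHeight_sub_le [DecidableEq K] [W.IsElliptic] :
    ∃ C, ∀ P Q : W.Point, |(P + Q).naiveHeight + (P - Q).naiveHeight -
      2 * (P.naiveHeight + Q.naiveHeight)| ≤ C := by
  obtain ⟨C₁, hC₁⟩ := abs_logHeight_sym2x_sub_le (W := W)
  obtain ⟨C₂, hC₂⟩ := abs_logHeight_addSubMap_sub_two_mul_logHeight_le W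
  refine ⟨3 * C₁ + C₂, fun P Q ↦ ?_⟩
  obtain ⟨c, hc, h⟩ := exists_smul_sym2x_add_sub P Q
  have h₁ := hC₁ P Q
  have h₂ := hC₁ (P + Q) (P - Q)
  have h₃ := hC₂ (P.sym2x Q)
  rw [h, logHeight_smul_eq_logHeight _ hc] at h₂
  rw [abs_le] at *
  constructor <;> linarith

end NaiveHeight

instance northcott_naiveHeight {K : Type*} [Field K] [NumberField K] {W : Affine K} :
    Northcott (naiveHeight : W.Point → ℝ) where
  finite_le B := by
    have hfin : (insert ![1, 0] ((fun x : K ↦ ![x, 1]) '' {x | logHeight₁ x ≤ B})).Finite :=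
      ((NumberField.finite_setOfPred_logHeight₁_le K B).image _).insert _
    refine (hfin.preimage' (f := xRep (W' := W)) fun v _ ↦ ?_).subset fun P hP ↦ ?_
    · by_cases hv : ∃ P : W.Point, P.xRep = v
      · obtain ⟨P, rfl⟩ := hv
        refine (Set.toFinite {P, -P}).subset fun Q hQ ↦ ?_
        exact xRep_eq_xRep_iff.mp hQ
      · convert Set.finite_empty
        ext P
        simpa using fun h ↦ hv ⟨P, h⟩
    · rcases P with _ | ⟨x, y, h⟩
      · exact .inl xRep_zero
      · refine .inr ⟨x, ?_, (xRep_some h).symm⟩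
        simpa [naiveHeight, logHeight₁_eq_logHeight] using hP

end WeierstrassCurve.Affine.Point

namespace AddCommGroup

variable {G : Type*} [AddCommGroup G]

/-- `x` lies in `2 • G + G[2]`. -/
def IsDoubleUpToTorsion (x : G) : Prop := ∃ t y : G, t + t = 0 ∧ y + y = x + t

lemma finiteIndex_range_two (hfin : {t : G | t + t = 0}.Finite)
    (H : ∀ x y : G, ¬ IsDoubleUpToTorsion x → ¬ IsDoubleUpToTorsion y →
      IsDoubleUpToTorsion (x + y)) :
    (nsmulAddMonoidHom (α := G) 2).range.FiniteIndex := by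
  obtain ⟨x₀, hx₀⟩ : ∃ x₀ : G, ∀ x, IsDoubleUpToTorsion x ∨ IsDoubleUpToTorsion (x + x₀) := by
    by_cases! hall : ∀ x : G, IsDoubleUpToTorsion x
    · exact ⟨0, fun x ↦ Or.inl (hall x)⟩
    · obtain ⟨x₀, h₀⟩ := hall
      exact ⟨x₀, fun x ↦ or_iff_not_imp_left.mpr fun hx ↦ H x x₀ hx h₀⟩
  have : Finite {t : G // t + t = 0} := hfin
  have hmk {x t y : G} (h : y + y = x + t) : (QuotientAddGroup.mk (-t) :
      G ⧸ (nsmulAddMonoidHom (α := G) 2).range) = QuotientAddGroup.mk x := by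
    refine QuotientAddGroup.eq.mpr ⟨y, ?_⟩
    simp [two_nsmul, h, add_comm]
  have : Finite (G ⧸ (nsmulAddMonoidHom (α := G) 2).range) := by
    refine Finite.of_surjective (Sum.elim (fun t : {t : G // t + t = 0} ↦ QuotientAddGroup.mk (-t.1))
      (fun t : {t : G // t + t = 0} ↦ QuotientAddGroup.mk (-(x₀ + t.1)))) fun z ↦ ?_
    induction z using QuotientAddGroup.induction_on with | H x
    obtain ⟨t, y, ht, h⟩ | ⟨t, y, ht, h⟩ := hx₀ x
    · exact ⟨Sum.inl ⟨t, ht⟩, hmk h⟩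
    · exact ⟨Sum.inr ⟨t, ht⟩, hmk (by rw [h, add_assoc])⟩
  exact AddSubgroup.finiteIndex_of_finite_quotient

lemma isAddKleinFour_of_card {T : Type*} [AddGroup T] (hcard : Nat.card T = 4)
    (h : ∀ t : T, t + t = 0) : IsAddKleinFour T where
  card_four := hcard
  exponent_two := by
    refine ((Nat.dvd_prime Nat.prime_two).mp (AddMonoid.exponent_dvd_of_forall_nsmul_eq_zero
      fun t ↦ by rw [two_nsmul, h])).resolve_left fun h1 ↦ ?_
    have := AddMonoid.exp_eq_one_iff.mp h1
    have := Nat.card_of_subsingleton (0 : T)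
    omega

lemma nonempty_addEquiv_of_addEquiv_prod {T : Type*} [AddCommGroup T] [Finite T] {n : ℕ}
    (f : G ≃+ (Fin n →₀ ℤ) × T) (htors : ∀ x : G, IsOfFinAddOrder x → x + x = 0)
    (hcard : {t : G | t + t = 0}.ncard = 4) (hinf : ∃ x : G, ¬ IsOfFinAddOrder x)
    (H : ∀ x y : G, ¬ IsDoubleUpToTorsion x → ¬ IsDoubleUpToTorsion y →
      IsDoubleUpToTorsion (x + y)) : Nonempty (G ≃+ ZMod 2 × ZMod 2 × ℤ) := by
  have fst_eq_zero {t : G} (ht : t + t = 0) : (f t).1 = 0 := by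
    have : (f t).1 + (f t).1 = 0 := by rw [← Prod.fst_add, ← map_add, ht, map_zero, Prod.fst_zero]
    ext i
    have := DFunLike.congr_fun this i
    simp only [Finsupp.add_apply, Finsupp.zero_apply] at this ⊢
    omega
  have even_of {x : G} (hx : IsDoubleUpToTorsion x) (i : Fin n) : Even ((f x).1 i) := by
    obtain ⟨t, y, ht, h⟩ := hx
    refine ⟨(f y).1 i, ?_⟩
    rw [← Finsupp.add_apply, ← Prod.fst_add, ← map_add, h, map_add, Prod.fst_add, fst_eq_zero ht,
      add_zero]
  have fin_order (t : T) : IsOfFinAddOrder (f.symm (0, t)) :=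
    (f.symm.toAddMonoidHom.comp (AddMonoidHom.inr _ T)).isOfFinAddOrder
      (isOfFinAddOrder_of_finite t)
  have two_T (t : T) : t + t = 0 := by
    have := congrArg f (htors _ (fin_order t))
    rw [map_add, f.apply_symm_apply, map_zero] at this
    exact congrArg Prod.snd this
  have card_T : Nat.card T = 4 := by
    rw [← hcard, ← Nat.card_coe_set_eq]
    refine Nat.card_congr ⟨fun t ↦ ⟨f.symm (0, t), htors _ (fin_order t)⟩, fun x ↦ (f x).2,
      fun t ↦ by simp, fun x ↦ ?_⟩
    ext
    simp [← fst_eq_zero x.2]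
  have hn : n = 1 := by
    obtain _ | _ | n := n
    · obtain ⟨x, hx⟩ := hinf
      refine absurd ?_ hx
      convert fin_order (f x).2
      rw [f.eq_symm_apply]
      ext i
      · exact i.elim0
      · rfl
    · rfl
    · have not_double {x : G} (i : Fin (n + 2)) (hx : (f x).1 i = 1) :
          ¬ IsDoubleUpToTorsion x := fun h ↦ by simpa [hx] using even_of h i
      have := H (f.symm (Finsupp.single 0 1, 0)) (f.symm (Finsupp.single 1 1, 0))
        (not_double 0 (by simp)) (not_double 1 (by simp))
      exact absurd this (not_double 0 (by simp))
  subst hn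
  have := isAddKleinFour_of_card card_T two_T
  obtain ⟨k⟩ := IsAddKleinFour.nonempty_addEquiv (G₁ := T) (G₂ := ZMod 2 × ZMod 2)
  exact ⟨f.trans (((Finsupp.uniqueAddEquiv 0).prodCongr k).trans
    (AddEquiv.prodComm.trans AddEquiv.prodAssoc))⟩

lemma nonempty_addEquiv_of_fg [AddGroup.FG G] (htors : ∀ x : G, IsOfFinAddOrder x → x + x = 0)
    (hcard : {t : G | t + t = 0}.ncard = 4) (hinf : ∃ x : G, ¬ IsOfFinAddOrder x)
    (H : ∀ x y : G, ¬ IsDoubleUpToTorsion x → ¬ IsDoubleUpToTorsion y →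
      IsDoubleUpToTorsion (x + y)) : Nonempty (G ≃+ ZMod 2 × ZMod 2 × ℤ) := by
  classical
  obtain ⟨n, ι, _, p, hp, e, ⟨f⟩⟩ := AddCommGroup.equiv_free_prod_directSum_zmod G
  have (i : ι) : NeZero (p i ^ e i) := ⟨pow_ne_zero _ (hp i).ne_zero⟩
  have : Finite (DirectSum ι fun i ↦ ZMod (p i ^ e i)) :=
    Finite.of_equiv _ (DirectSum.addEquivProd _).symm.toEquiv
  exact nonempty_addEquiv_of_addEquiv_prod f htors hcard hinf H

end AddCommGroup

namespace twinCurvePlus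

lemma isSquare_and_isSquare_of_coprime {m n : ℕ} (hmn : m.Coprime n) (h : IsSquare (m * n)) :
    IsSquare m ∧ IsSquare n := by
  obtain ⟨r, hr⟩ := h
  refine ⟨?_, ?_⟩
  · obtain ⟨d, hd⟩ := exists_eq_pow_of_mul_eq_pow (Nat.isUnit_iff.mpr hmn) (hr.trans (sq r).symm)
    exact ⟨d, hd.trans (sq d)⟩
  · obtain ⟨d, hd⟩ := exists_eq_pow_of_mul_eq_pow (Nat.isUnit_iff.mpr hmn.symm)
      ((mul_comm n m).trans (hr.trans (sq r).symm))
    exact ⟨d, hd.trans (sq d)⟩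

/-- If a product of three positive integers with pairwise coprime gcds is a square, then each of
them is a square up to the gcds. -/
lemma exists_sq_of_isSquare_mul {A B C : ℕ} (hA : 0 < A) (hB : 0 < B)
    (h₁₂ : (A.gcd B).Coprime (A.gcd C)) (h₁₃ : (A.gcd B).Coprime (B.gcd C))
    (h₂₃ : (A.gcd C).Coprime (B.gcd C)) (h : IsSquare (A * B * C)) :
    ∃ a b c : ℕ, A = A.gcd B * A.gcd C * a ^ 2 ∧ B = A.gcd B * B.gcd C * b ^ 2 ∧
      C = A.gcd C * B.gcd C * c ^ 2 := by
  have g₁ : 0 < A.gcd B := Nat.gcd_pos_of_pos_left _ hA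
  have g₂ : 0 < A.gcd C := Nat.gcd_pos_of_pos_left _ hA
  have g₃ : 0 < B.gcd C := Nat.gcd_pos_of_pos_left _ hB
  obtain ⟨A', hA'⟩ := h₁₂.mul_dvd_of_dvd_of_dvd (A.gcd_dvd_left B) (A.gcd_dvd_left C)
  obtain ⟨B', hB'⟩ := h₁₃.mul_dvd_of_dvd_of_dvd (A.gcd_dvd_right B) (B.gcd_dvd_left C)
  obtain ⟨C', hC'⟩ := h₂₃.mul_dvd_of_dvd_of_dvd (A.gcd_dvd_right C) (B.gcd_dvd_right C)
  set g := A.gcd B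
  set k := A.gcd C
  set l := B.gcd C
  have coprime_of {u v X Y t : ℕ} (hu : t * u ∣ X) (hv : t * v ∣ Y) (ht : 0 < t)
      (hXY : X.gcd Y = t) : u.Coprime v := by
    have : t * u.gcd v ∣ t := by
      conv_rhs => rw [← hXY]
      exact Nat.dvd_gcd ((mul_dvd_mul_left t (Nat.gcd_dvd_left u v)).trans hu)
        ((mul_dvd_mul_left t (Nat.gcd_dvd_right u v)).trans hv)
    exact Nat.dvd_one.mp (Nat.dvd_of_mul_dvd_mul_left ht (by simpa using this))
  have cAB : A'.Coprime B' := coprime_of (t := g) ⟨k, by rw [hA']; ring⟩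
    ⟨l, by rw [hB']; ring⟩ g₁ rfl
  have cAC : A'.Coprime C' := coprime_of (t := k) ⟨g, by rw [hA']; ring⟩
    ⟨l, by rw [hC']; ring⟩ g₂ rfl
  have cBC : B'.Coprime C' := coprime_of (t := l) ⟨g, by rw [hB']; ring⟩
    ⟨k, by rw [hC']; ring⟩ g₃ rfl
  have hsq : IsSquare (A' * B' * C') := by
    obtain ⟨r, hr⟩ := h
    have hr' : (g * k * l) ^ 2 * (A' * B' * C') = r ^ 2 := by
      rw [sq r, ← hr]
      conv_rhs => rw [hA', hB', hC']
      ring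
    obtain ⟨s, rfl⟩ := (Nat.pow_dvd_pow_iff two_ne_zero).mp (Dvd.intro _ hr')
    refine ⟨s, ?_⟩
    have : 0 < (g * k * l) ^ 2 := by positivity
    exact Nat.eq_of_mul_eq_mul_left this (by rw [hr']; ring)
  obtain ⟨hAB, c, rfl⟩ := isSquare_and_isSquare_of_coprime (Nat.Coprime.mul_left cAC cBC) hsq
  obtain ⟨⟨a, rfl⟩, b, rfl⟩ := isSquare_and_isSquare_of_coprime cAB hAB
  exact ⟨a, b, c, by rw [hA', sq], by rw [hB', sq], by rw [hC', sq]⟩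

/-- A binary form `u² - d v²` is anisotropic modulo a prime for which `d` is not a square. -/
lemma dvd_of_sq_eq_mul_sq {l : ℕ} [Fact l.Prime] {d : ZMod l} (hd : ¬ IsSquare d) {u v : ℕ}
    (h : (u : ZMod l) ^ 2 = d * (v : ZMod l) ^ 2) : l ∣ u ∧ l ∣ v := by
  have hv : (v : ZMod l) = 0 := by
    by_contra hv
    exact hd ⟨u / v, by field_simp; rw [h]⟩
  rw [hv] at h
  exact ⟨(ZMod.natCast_eq_zero_iff _ _).mp (by simpa using h),
    (ZMod.natCast_eq_zero_iff _ _).mp hv⟩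

/-- The complete `2`-descent for integral data: `m / N` is a positive abscissa of a point. -/
lemma descent_nat {p q m N : ℕ} (hp : p.Prime) (hq : q.Prime) (hpq : q = p + 2) (hmod : p % 8 = 3)
    (hm : 0 < m) (hN : 0 < N) (hmN : m.Coprime N)
    (h : IsSquare (N * (m * (m + p * N) * (m + q * N)))) :
    ∃ n a b c : ℕ, N = n ^ 2 ∧
      ((m = a ^ 2 ∧ m + p * N = b ^ 2 ∧ m + q * N = c ^ 2) ∨
      (m = q * a ^ 2 ∧ m + p * N = 2 * b ^ 2 ∧ m + q * N = 2 * q * c ^ 2) ∨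
      (m = p * q * a ^ 2 ∧ m + p * N = p * b ^ 2 ∧ m + q * N = q * c ^ 2) ∨
      (m = p * a ^ 2 ∧ m + p * N = 2 * p * b ^ 2 ∧ m + q * N = 2 * c ^ 2)) := by
  have : Fact p.Prime := ⟨hp⟩
  have : Fact q.Prime := ⟨hq⟩
  have hp2 : p ≠ 2 := by rintro rfl; omega
  have hq2 : q ≠ 2 := by have := hp.two_le; omega
  have two_p : ¬ IsSquare (2 : ZMod p) := by rw [ZMod.exists_sq_eq_two_iff hp2]; omega
  have neg_two_q : ¬ IsSquare (-2 : ZMod q) := by rw [ZMod.exists_sq_eq_neg_two_iff hq2]; omega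
  have cBN : (m + p * N).Coprime N := by simpa using hmN
  have cCN : (m + q * N).Coprime N := by simpa using hmN
  obtain ⟨⟨n, hn⟩, hsq⟩ :=
    isSquare_and_isSquare_of_coprime ((hmN.mul_left cBN).mul_left cCN).symm h
  have g₁ : m.gcd (m + p * N) = 1 ∨ m.gcd (m + p * N) = p := by
    refine (Nat.dvd_prime hp).mp ((hmN.coprime_dvd_left (Nat.gcd_dvd_left _ _)).dvd_of_dvd_mul_right
      ((Nat.dvd_add_right (Nat.gcd_dvd_left m _)).mp (Nat.gcd_dvd_right m _)))
  have g₂ : m.gcd (m + q * N) = 1 ∨ m.gcd (m + q * N) = q := by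
    refine (Nat.dvd_prime hq).mp ((hmN.coprime_dvd_left (Nat.gcd_dvd_left _ _)).dvd_of_dvd_mul_right
      ((Nat.dvd_add_right (Nat.gcd_dvd_left m _)).mp (Nat.gcd_dvd_right m _)))
  have g₃ : (m + p * N).gcd (m + q * N) = 1 ∨ (m + p * N).gcd (m + q * N) = 2 := by
    have hC : m + q * N = (m + p * N) + 2 * N := by rw [hpq]; ring
    refine (Nat.dvd_prime Nat.prime_two).mp
      ((cBN.coprime_dvd_left (Nat.gcd_dvd_left _ (m + q * N))).dvd_of_dvd_mul_right
      ((Nat.dvd_add_right (Nat.gcd_dvd_left (m + p * N) _)).mp ?_))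
    rw [← hC]
    exact Nat.gcd_dvd_right _ _
  have cpq : p.Coprime q := (Nat.coprime_primes hp hq).mpr (by omega)
  have cp2 : p.Coprime 2 := (Nat.coprime_primes hp Nat.prime_two).mpr hp2
  have cq2 : q.Coprime 2 := (Nat.coprime_primes hq Nat.prime_two).mpr hq2
  obtain ⟨a, b, c, hA, hB, hC⟩ := exists_sq_of_isSquare_mul (A := m) (B := m + p * N)
    (C := m + q * N) hm (by positivity)
    (by rcases g₁ with g₁ | g₁ <;> rcases g₂ with g₂ | g₂ <;> rw [g₁, g₂] <;>
      first | exact cpq | simp)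
    (by rcases g₁ with g₁ | g₁ <;> rcases g₃ with g₃ | g₃ <;> rw [g₁, g₃] <;>
      first | exact cp2 | simp)
    (by rcases g₂ with g₂ | g₂ <;> rcases g₃ with g₃ | g₃ <;> rw [g₂, g₃] <;>
      first | exact cq2 | simp)
    hsq
  have not_dvd {l : ℕ} (hl : l.Prime) (h₁ : l ∣ m) (h₂ : l ∣ n) : False :=
    hl.one_lt.ne' (Nat.dvd_one.mp (hmN ▸ Nat.dvd_gcd h₁ (hn ▸ h₂.mul_right n)))
  have hp0 : (p : ZMod p) = 0 := ZMod.natCast_self p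
  have hq0 : (q : ZMod q) = 0 := ZMod.natCast_self q
  have hqp : (q : ZMod p) = 2 := by rw [hpq]; simp
  have hpq' : (p : ZMod q) = -2 := by
    have : ((p + 2 : ℕ) : ZMod q) = 0 := hpq ▸ hq0
    push_cast at this
    linear_combination this
  have hpN : m.gcd (m + p * N) = 1 → ¬ p ∣ m := fun g₁ hd ↦ hp.one_lt.ne'
    (Nat.dvd_one.mp (g₁ ▸ Nat.dvd_gcd hd (dvd_add hd (dvd_mul_right p N))))
  rw [← sq] at hn
  refine ⟨n, a, b, c, hn, ?_⟩
  rcases g₁ with g₁ | g₁ <;> rcases g₂ with g₂ | g₂ <;> rcases g₃ with g₃ | g₃ <;>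
    rw [g₁, g₂] at hA <;> rw [g₁, g₃] at hB <;> rw [g₂, g₃] at hC
  · exact Or.inl ⟨by simpa using hA, by simpa using hB, by simpa using hC⟩
  · have eA := congrArg (Nat.cast : ℕ → ZMod p) hA
    have eB := congrArg (Nat.cast : ℕ → ZMod p) hB
    push_cast [hp0] at eA eB
    have := (dvd_of_sq_eq_mul_sq two_p (u := a) (v := b) (by linear_combination eB - eA)).1
    exact absurd (hA ▸ dvd_mul_of_dvd_right (dvd_pow this two_ne_zero) _) (hpN g₁)
  · have eA := congrArg (Nat.cast : ℕ → ZMod q) hA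
    have eB := congrArg (Nat.cast : ℕ → ZMod q) hB
    have eN := congrArg (Nat.cast : ℕ → ZMod q) hn
    push_cast [hq0, hpq'] at eA eB eN
    have := (dvd_of_sq_eq_mul_sq neg_two_q (u := b) (v := n)
      (by linear_combination eA - eB - 2 * eN)).2
    exact (not_dvd hq ⟨a ^ 2, by rw [hA, one_mul]⟩ this).elim
  · exact Or.inr (Or.inl ⟨by linarith, by linarith, by linarith⟩)
  · have eA := congrArg (Nat.cast : ℕ → ZMod p) hA
    have eC := congrArg (Nat.cast : ℕ → ZMod p) hC
    have eN := congrArg (Nat.cast : ℕ → ZMod p) hn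
    push_cast [hp0, hqp] at eA eC eN
    have := (dvd_of_sq_eq_mul_sq two_p (u := c) (v := n)
      (by linear_combination eA - eC + 2 * eN)).2
    exact (not_dvd hp ⟨a ^ 2, by rw [hA, mul_one]⟩ this).elim
  · exact Or.inr (Or.inr (Or.inr ⟨by linarith, by linarith, by linarith⟩))
  · exact Or.inr (Or.inr (Or.inl ⟨by linarith, by linarith, by linarith⟩))
  · have hC' : p * a ^ 2 + n ^ 2 = 2 * c ^ 2 := by
      refine Nat.eq_of_mul_eq_mul_left hq.pos ?_
      linear_combination hC - hA - q * hn
    have eC := congrArg (Nat.cast : ℕ → ZMod p) hC'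
    push_cast [hp0] at eC
    have := (dvd_of_sq_eq_mul_sq two_p (u := n) (v := c) (by linear_combination eC)).1
    exact (not_dvd hp ⟨q * a ^ 2, by rw [hA, mul_assoc]⟩ this).elim

end twinCurvePlus

namespace twinCurvePlus

open AddCommGroup WeierstrassCurve.Affine WeierstrassCurve.Affine.Point

variable {p q : ℤ}

lemma equation_iff (x y : ℚ) :
    (twinCurvePlus p q).toAffine.Equation x y ↔ y ^ 2 = x * (x + p) * (x + q) := by
  rw [WeierstrassCurve.Affine.equation_iff]
  simp only [twinCurvePlus]
  constructor <;> intro h <;> linear_combination h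

lemma isElliptic (hp : p ≠ 0) (hq : q ≠ 0) (hpq : p ≠ q) : (twinCurvePlus p q).IsElliptic := by
  have hΔ : (twinCurvePlus p q).Δ = (4 * p * q * (p - q)) ^ 2 := by
    simp only [WeierstrassCurve.Δ, WeierstrassCurve.b₂, WeierstrassCurve.b₄, WeierstrassCurve.b₆,
      WeierstrassCurve.b₈, twinCurvePlus]
    ring
  have hne : (p : ℚ) - q ≠ 0 := sub_ne_zero.mpr (by exact_mod_cast hpq)
  have hp' : (p : ℚ) ≠ 0 := by exact_mod_cast hp
  have hq' : (q : ℚ) ≠ 0 := by exact_mod_cast hq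
  refine ⟨isUnit_iff_ne_zero.mpr ?_⟩
  rw [hΔ]
  positivity

lemma negY_eq (x y : ℚ) : (twinCurvePlus p q).toAffine.negY x y = -y := by
  simp [negY, twinCurvePlus]

lemma addX_eq (x₁ x₂ ℓ : ℚ) :
    (twinCurvePlus p q).toAffine.addX x₁ x₂ ℓ = ℓ ^ 2 - (p + q) - x₁ - x₂ := by
  simp [addX, twinCurvePlus]

lemma addY_eq (x₁ x₂ y₁ ℓ : ℚ) : (twinCurvePlus p q).toAffine.addY x₁ x₂ y₁ ℓ =
    -(ℓ * ((ℓ ^ 2 - (p + q) - x₁ - x₂) - x₁) + y₁) := by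
  rw [addY, negY_eq, negAddY, addX_eq]

lemma slope_self {x y : ℚ} (hy : y ≠ 0) : (twinCurvePlus p q).toAffine.slope x x y y =
    (3 * x ^ 2 + 2 * (p + q) * x + p * q) / (2 * y) := by
  rw [slope_of_Y_ne rfl (by rwa [negY_eq, ne_eq, self_eq_neg]), negY_eq]
  simp only [twinCurvePlus]
  congr 1 <;> ring

lemma add_self_eq_zero_iff {x y : ℚ} (h : (twinCurvePlus p q).toAffine.Nonsingular x y) :
    some x y h + some x y h = 0 ↔ y = 0 := by
  rw [add_eq_zero_iff_eq_neg, neg_some, some.injEq]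
  simp [twinCurvePlus, self_eq_neg]

lemma add_self_of_ne_zero {x y : ℚ} (h : (twinCurvePlus p q).toAffine.Nonsingular x y)
    (hy : y ≠ 0) : ∃ (y' : ℚ) (h' : (twinCurvePlus p q).toAffine.Nonsingular
      (((x ^ 2 - p * q) / (2 * y)) ^ 2) y'), some x y h + some x y h = some _ y' h' := by
  have hE := (equation_iff x y).mp h.1
  have hX : (twinCurvePlus p q).toAffine.addX x x ((twinCurvePlus p q).toAffine.slope x x y y) =
      ((x ^ 2 - p * q) / (2 * y)) ^ 2 := by
    rw [addX_eq, slope_self hy]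
    field_simp
    linear_combination -4 * (p + q + 2 * x) * hE
  rw [← hX]
  exact ⟨_, _, add_self_of_Y_ne (by rwa [negY_eq, ne_eq, self_eq_neg])⟩

lemma isSquare_double {x y : ℚ} (hE : y ^ 2 = x * (x + p) * (x + q)) (hy : y ≠ 0) :
    IsSquare (((x ^ 2 - p * q) / (2 * y)) ^ 2 + p) ∧
      IsSquare (((x ^ 2 - p * q) / (2 * y)) ^ 2 + q) := by
  constructor
  · refine ⟨(x ^ 2 + 2 * p * x + p * q) / (2 * y), ?_⟩
    field_simp
    linear_combination 4 * p * hE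
  · refine ⟨(x ^ 2 + 2 * q * x + p * q) / (2 * y), ?_⟩
    field_simp
    linear_combination 4 * q * hE

/-- A point whose abscissa differs from each `2`-torsion abscissa by a square is a double. -/
lemma exists_add_self_eq (hp : p ≠ 0) (hq : q ≠ 0) (hpq : p ≠ q) {x y : ℚ}
    (h : (twinCurvePlus p q).toAffine.Nonsingular x y) (hx : IsSquare x)
    (hxp : IsSquare (x + p)) (hxq : IsSquare (x + q)) :
    ∃ Q : (twinCurvePlus p q).toAffine.Point, Q + Q = some x y h := by
  have := isElliptic hp hq hpq
  have hE := (equation_iff x y).mp h.1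
  have hp' : (p : ℚ) ≠ 0 := by exact_mod_cast hp
  have hq' : (q : ℚ) ≠ 0 := by exact_mod_cast hq
  have hpq' : (p : ℚ) ≠ q := by exact_mod_cast hpq
  obtain ⟨β, hβ⟩ := hxp
  obtain ⟨γ, hγ⟩ := hxq
  obtain ⟨α, hα, hy⟩ : ∃ α, x = α * α ∧ y = α * β * γ := by
    obtain ⟨α, hα⟩ := hx
    have : y ^ 2 = (α * β * γ) ^ 2 := by
      rw [hE, hβ, hγ, hα]
      ring
    obtain hy | hy := sq_eq_sq_iff_eq_or_eq_neg.mp this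
    · exact ⟨α, hα, hy⟩
    · exact ⟨-α, by rw [hα]; ring, by rw [hy]; ring⟩
  have hpe : (p : ℚ) = β * β - α * α := by linear_combination hβ - hα
  have hqe : (q : ℚ) = γ * γ - α * α := by linear_combination hγ - hα
  have hαβ : α + β ≠ 0 := fun h0 ↦ hp' (by linear_combination hpe + (β - α) * h0)
  have hαγ : α + γ ≠ 0 := fun h0 ↦ hq' (by linear_combination hqe + (γ - α) * h0)
  have hβγ : β + γ ≠ 0 := fun h0 ↦ hpq' (by linear_combination hpe - hqe + (β - γ) * h0)
  have hy₀ : (α + β) * (α + γ) * (β + γ) ≠ 0 := by positivity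
  have hE₀ : (twinCurvePlus p q).toAffine.Equation ((α + β) * (α + γ))
      ((α + β) * (α + γ) * (β + γ)) := by
    rw [equation_iff, hpe, hqe]
    ring
  refine ⟨some _ _ ((equation_iff_nonsingular).mp hE₀), ?_⟩
  rw [add_self_of_Y_ne (by rwa [negY_eq, ne_eq, self_eq_neg])]
  have hslope : (twinCurvePlus p q).toAffine.slope ((α + β) * (α + γ)) ((α + β) * (α + γ))
      ((α + β) * (α + γ) * (β + γ)) ((α + β) * (α + γ) * (β + γ)) = α + β + γ := by
    rw [slope_self hy₀, div_eq_iff (by positivity), hpe, hqe]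
    ring
  rw [some.injEq, hslope, addX_eq, addY_eq, hpe, hqe, hα, hy]
  constructor <;> ring

lemma addX_add_mul {x₁ x₂ y₁ y₂ : ℚ} (h₁ : y₁ ^ 2 = x₁ * (x₁ + p) * (x₁ + q))
    (h₂ : y₂ ^ 2 = x₂ * (x₂ + p) * (x₂ + q)) (hx : x₁ ≠ x₂) {e : ℚ}
    (he : e * (e - p) * (e - q) = 0) :
    ((twinCurvePlus p q).toAffine.addX x₁ x₂ ((twinCurvePlus p q).toAffine.slope x₁ x₂ y₁ y₂) +
      e) * ((x₁ + e) * (x₂ + e)) = (((x₁ + e) * y₂ - (x₂ + e) * y₁) / (x₁ - x₂)) ^ 2 := by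
  have hx' : x₁ - x₂ ≠ 0 := sub_ne_zero.mpr hx
  rw [addX_eq, slope_of_X_ne hx]
  field_simp
  linear_combination (x₂ + e) * (x₁ - x₂) * h₁ - (x₁ + e) * (x₁ - x₂) * h₂ + (x₁ - x₂) ^ 2 * he

/-- The square class of the abscissa, in `(ℚˣ/ℚˣ²)³`, of the nontrivial coset of `2 E₊(ℚ)`. -/
def IsGeneratorClass (p q : ℤ) (x : ℚ) : Prop :=
  0 < x ∧ IsSquare (q * x) ∧ IsSquare (2 * (x + p)) ∧ IsSquare (2 * q * (x + q))

lemma descent_rat (hp : Prime p) (hq : Prime q) (hp0 : 0 < p) (hpq : q = p + 2)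
    (hmod : p % 8 = 3) {x : ℚ} (hx : 0 < x) (h : IsSquare (x * (x + p) * (x + q))) :
    (IsSquare x ∧ IsSquare (x + p) ∧ IsSquare (x + q)) ∨ IsGeneratorClass p q x ∨
      (IsSquare (p * q * x) ∧ IsSquare (p * (x + p)) ∧ IsSquare (q * (x + q))) ∨
      (IsSquare (p * x) ∧ IsSquare (2 * p * (x + p)) ∧ IsSquare (2 * (x + q))) := by
  lift p to ℕ using hp0.le
  lift q to ℕ using by omega
  obtain ⟨m, N, hN, hcop, rfl⟩ : ∃ m N : ℕ, 0 < N ∧ m.Coprime N ∧ x = m / N := by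
    obtain ⟨m, hm⟩ := Int.eq_ofNat_of_zero_le (Rat.num_nonneg.mpr hx.le)
    refine ⟨m, x.den, x.den_pos, by simpa [hm] using x.reduced, ?_⟩
    conv_lhs => rw [← Rat.num_div_den x, hm]
    rfl
  have hN' : (N : ℚ) ≠ 0 := by exact_mod_cast hN.ne'
  have hm : 0 < m := by
    rw [Nat.pos_iff_ne_zero]
    rintro rfl
    simp at hx
  have hsq : IsSquare (N * (m * (m + p * N) * (m + q * N))) := by
    rw [← Rat.isSquare_natCast_iff]
    have : ((N * (m * (m + p * N) * (m + q * N)) : ℕ) : ℚ) =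
        (N : ℚ) ^ 2 * (N : ℚ) ^ 2 * (m / N * (m / N + (p : ℤ)) * (m / N + (q : ℤ))) := by
      push_cast
      field_simp
    rw [this]
    exact (IsSquare.mul_self _).mul h
  obtain ⟨n, a, b, c, rfl, H⟩ := descent_nat (Nat.prime_iff_prime_int.mpr hp)
    (Nat.prime_iff_prime_int.mpr hq) (by omega) (by omega) hm hN hcop hsq
  have key {k r t : ℕ} (h : m + k * n ^ 2 = r * t ^ 2) :
      IsSquare ((r : ℚ) * ((m : ℚ) / (n ^ 2 : ℕ) + k)) := by
    refine ⟨r * t / n, ?_⟩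
    have h' : (m : ℚ) + k * n ^ 2 = r * t ^ 2 := by exact_mod_cast h
    have hn : (n : ℚ) ≠ 0 := by simpa using hN'
    push_cast
    field_simp
    linear_combination (r : ℚ) * h'
  have key₀ {r t : ℕ} (h : m = r * t ^ 2) : IsSquare ((r : ℚ) * ((m : ℚ) / (n ^ 2 : ℕ))) := by
    simpa using key (k := 0) (by simpa using h)
  simp only [IsGeneratorClass, Int.cast_natCast]
  refine H.imp ?_ (Or.imp ?_ (Or.imp ?_ ?_)) <;> rintro ⟨h₁, h₂, h₃⟩
  · exact ⟨by simpa using key₀ (r := 1) (by simpa using h₁),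
      by simpa using key (r := 1) (by simpa using h₂),
      by simpa using key (r := 1) (by simpa using h₃)⟩
  · exact ⟨hx, by simpa using key₀ h₁, by simpa using key h₂, by simpa using key h₃⟩
  all_goals exact ⟨by simpa using key₀ h₁, by simpa using key h₂, by simpa using key h₃⟩

lemma exists_add_zero (hp : p ≠ 0) (hq : q ≠ 0) (hpq : p ≠ q) {x y : ℚ}
    (h : (twinCurvePlus p q).toAffine.Nonsingular x y) (hx : x ≠ 0) :
    ∃ T : (twinCurvePlus p q).toAffine.Point, T + T = 0 ∧
      ∃ (y' : ℚ) (h' : (twinCurvePlus p q).toAffine.Nonsingular (p * q / x) y'),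
        some x y h + T = some _ y' h' := by
  have := isElliptic hp hq hpq
  have hE := (equation_iff x y).mp h.1
  have h₀ : (twinCurvePlus p q).toAffine.Nonsingular 0 0 :=
    equation_iff_nonsingular.mp ((equation_iff 0 0).mpr (by simp))
  have hX : (twinCurvePlus p q).toAffine.addX x 0
      ((twinCurvePlus p q).toAffine.slope x 0 y 0) = p * q / x := by
    rw [addX_eq, slope_of_X_ne hx]
    field_simp
    linear_combination x * hE
  refine ⟨some 0 0 h₀, (add_self_eq_zero_iff h₀).mpr rfl, ?_⟩
  rw [← hX]
  exact ⟨_, _, add_of_X_ne hx⟩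

lemma exists_add_neg_q (hp : p ≠ 0) (hq : q ≠ 0) (hpq : p ≠ q) {x y : ℚ}
    (h : (twinCurvePlus p q).toAffine.Nonsingular x y) (hx : x + q ≠ 0) :
    ∃ T : (twinCurvePlus p q).toAffine.Point, T + T = 0 ∧
      ∃ (y' : ℚ) (h' : (twinCurvePlus p q).toAffine.Nonsingular (-(q * (x + p)) / (x + q)) y'),
        some x y h + T = some _ y' h' := by
  have := isElliptic hp hq hpq
  have hE := (equation_iff x y).mp h.1
  have h₀ : (twinCurvePlus p q).toAffine.Nonsingular (-q) 0 :=
    equation_iff_nonsingular.mp ((equation_iff (-q) 0).mpr (by simp))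
  have hx' : x ≠ -q := fun h0 ↦ hx (by rw [h0]; ring)
  have hX : (twinCurvePlus p q).toAffine.addX x (-q)
      ((twinCurvePlus p q).toAffine.slope x (-q) y 0) = -(q * (x + p)) / (x + q) := by
    rw [addX_eq, slope_of_X_ne hx', sub_neg_eq_add]
    field_simp
    linear_combination (x + q) * hE
  refine ⟨some (-q) 0 h₀, (add_self_eq_zero_iff h₀).mpr rfl, ?_⟩
  rw [← hX]
  exact ⟨_, _, add_of_X_ne hx'⟩

/-- The points whose abscissa lies in the distinguished square class. -/
def IsGeneratorPoint (P : (twinCurvePlus p q).toAffine.Point) : Prop :=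
  ∃ (x y : ℚ) (h : (twinCurvePlus p q).toAffine.Nonsingular x y),
    P = some x y h ∧ IsGeneratorClass p q x

lemma exists_double_or_generator_of_pos (hp : Prime p) (hq : Prime q) (hp0 : 0 < p)
    (hpq : q = p + 2) (hmod : p % 8 = 3) {x y : ℚ}
    (h : (twinCurvePlus p q).toAffine.Nonsingular x y) (hx : 0 < x) :
    ∃ T : (twinCurvePlus p q).toAffine.Point, T + T = 0 ∧
      ((∃ Q, Q + Q = some x y h + T) ∨ IsGeneratorPoint (some x y h + T)) := by
  have hpq' : p ≠ q := by omega
  have hp' : (0 : ℚ) < p := by exact_mod_cast hp0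
  have hq' : (0 : ℚ) < q := by rw [hpq]; push_cast; positivity
  have hE := (equation_iff x y).mp h.1
  rcases descent_rat hp hq hp0 hpq hmod hx (hE ▸ IsSquare.sq y) with H | H | H | H
  · exact ⟨0, add_zero 0, Or.inl (by
      rw [add_zero]
      exact exists_add_self_eq hp.ne_zero hq.ne_zero hpq' h H.1 H.2.1 H.2.2)⟩
  · exact ⟨0, add_zero 0, Or.inr (by rw [add_zero]; exact ⟨x, y, h, rfl, H⟩)⟩
  · obtain ⟨T, hT, y', h', hadd⟩ := exists_add_zero hp.ne_zero hq.ne_zero hpq' h hx.ne'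
    refine ⟨T, hT, Or.inl ?_⟩
    rw [hadd]
    obtain ⟨⟨r, hr⟩, ⟨s, hs⟩, ⟨t, ht⟩⟩ := H
    refine exists_add_self_eq hp.ne_zero hq.ne_zero hpq' h' ⟨r / x, ?_⟩ ⟨r * t / (q * x), ?_⟩
      ⟨r * s / (p * x), ?_⟩
    · field_simp
      linear_combination hr
    · field_simp
      linear_combination (q * (x + q)) * hr + r ^ 2 * ht
    · field_simp
      linear_combination (p * (x + p)) * hr + r ^ 2 * hs
  · obtain ⟨T, hT, y', h', hadd⟩ := exists_add_zero hp.ne_zero hq.ne_zero hpq' h hx.ne'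
    refine ⟨T, hT, Or.inr ?_⟩
    rw [hadd]
    obtain ⟨⟨r, hr⟩, ⟨s, hs⟩, ⟨t, ht⟩⟩ := H
    refine ⟨_, y', h', rfl, by positivity, ⟨r * q / x, ?_⟩, ⟨r * t / x, ?_⟩,
      ⟨r * s * q / (p * x), ?_⟩⟩
    · field_simp
      linear_combination hr
    · field_simp
      linear_combination (2 * (x + q)) * hr + r ^ 2 * ht
    · field_simp
      linear_combination (2 * p * (x + p)) * hr + r ^ 2 * hs

lemma exists_double_or_generator (hp : Prime p) (hq : Prime q) (hp0 : 0 < p)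
    (hpq : q = p + 2) (hmod : p % 8 = 3) (P : (twinCurvePlus p q).toAffine.Point) :
    ∃ T : (twinCurvePlus p q).toAffine.Point, T + T = 0 ∧
      ((∃ Q, Q + Q = P + T) ∨ IsGeneratorPoint (P + T)) := by
  have hpq' : p ≠ q := by omega
  have hp' : (0 : ℚ) < p := by exact_mod_cast hp0
  have hq' : (0 : ℚ) < q := by rw [hpq]; push_cast; positivity
  have hlt : (p : ℚ) < q := by exact_mod_cast (show p < q by omega)
  match P with
  | .zero => exact ⟨0, add_zero 0, Or.inl ⟨0, rfl⟩⟩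
  | .some x y h =>
    have hE := (equation_iff x y).mp h.1
    rcases eq_or_ne y 0 with rfl | hy
    · have h2 := (add_self_eq_zero_iff h).mpr rfl
      exact ⟨_, h2, Or.inl ⟨0, by rw [h2, add_zero]⟩⟩
    have hpos : 0 < x * (x + p) * (x + q) := hE ▸ by positivity
    rcases lt_trichotomy x 0 with hx | rfl | hx
    · have hxq : 0 < x + q := by
        by_contra! hle
        nlinarith [mul_nonneg (neg_nonneg.mpr hle) (neg_nonneg.mpr (show x + p ≤ 0 by linarith))]
      have hxp : x + p < 0 := by
        by_contra! hle
        nlinarith [mul_nonneg hxq.le hle]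
      obtain ⟨T, hT, y', h', hadd⟩ := exists_add_neg_q hp.ne_zero hq.ne_zero hpq' h hxq.ne'
      obtain ⟨T', hT', H⟩ := exists_double_or_generator_of_pos hp hq hp0 hpq hmod h'
        (div_pos (by nlinarith) hxq)
      rw [← hadd, add_assoc] at H
      exact ⟨T + T', by rw [add_add_add_comm, hT, hT', add_zero], H⟩
    · simp at hpos
    · exact exists_double_or_generator_of_pos hp hq hp0 hpq hmod h hx

lemma isSquare_of_isSquare_mul {u a b k : ℚ} (hk : k ≠ 0) (ha : a ≠ 0) (hb : b ≠ 0)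
    (hka : IsSquare (k * a)) (hkb : IsSquare (k * b)) (h : IsSquare (u * (a * b))) :
    IsSquare u := by
  have : u = u * (a * b) * ((k * a) * (k * b)) / ((k * a * b) * (k * a * b)) := by
    field_simp
  rw [this]
  exact (h.mul (hka.mul hkb)).div (IsSquare.mul_self _)

lemma IsGeneratorPoint.add (hp0 : 0 < p) (hpq : q = p + 2)
    {P Q : (twinCurvePlus p q).toAffine.Point} (hP : IsGeneratorPoint P)
    (hQ : IsGeneratorPoint Q) : ∃ R, R + R = P + Q := by
  have hpq' : p ≠ q := by omega
  have hp' : (0 : ℚ) < p := by exact_mod_cast hp0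
  have hq' : (0 : ℚ) < q := by rw [hpq]; push_cast; positivity
  obtain ⟨x₁, y₁, h₁, rfl, hx₁, a₁, b₁, c₁⟩ := hP
  obtain ⟨x₂, y₂, h₂, rfl, hx₂, a₂, b₂, c₂⟩ := hQ
  have hE₁ := (equation_iff x₁ y₁).mp h₁.1
  have hE₂ := (equation_iff x₂ y₂).mp h₂.1
  rcases eq_or_ne x₁ x₂ with rfl | hx
  · rcases Y_eq_of_X_eq h₁.1 h₂.1 rfl with rfl | hy
    · exact ⟨_, rfl⟩
    · exact ⟨0, by rw [add_of_Y_eq rfl hy, add_zero]⟩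
  · rw [add_of_X_ne hx]
    have key {e : ℚ} (he : e * (e - p) * (e - q) = 0) : IsSquare _ :=
      ⟨_, (addX_add_mul hE₁ hE₂ hx he).trans (sq _)⟩
    refine exists_add_self_eq hp0.ne' (by omega) hpq' _ ?_ ?_ ?_
    · refine isSquare_of_isSquare_mul hq'.ne' hx₁.ne' hx₂.ne' a₁ a₂ ?_
      simpa using key (e := 0) (by ring)
    · exact isSquare_of_isSquare_mul two_ne_zero (by positivity) (by positivity) b₁ b₂
        (key (e := p) (by ring))
    · exact isSquare_of_isSquare_mul (by positivity) (by positivity) (by positivity) c₁ c₂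
        (key (e := q) (by ring))

/-- The `2`-adic absolute value of the abscissa, with value `0` at the point at infinity. -/
def normX : (twinCurvePlus p q).toAffine.Point → ℚ
  | .zero => 0
  | .some x _ _ => padicNorm 2 x

lemma padicNorm_two_two : padicNorm 2 2 = 1 / 2 := by
  simpa using padicNorm.padicNorm_p (p := 2) (by norm_num)

lemma padicNorm_add_eq_left {a b : ℚ} (h : padicNorm 2 b < padicNorm 2 a) :
    padicNorm 2 (a + b) = padicNorm 2 a := by
  rw [padicNorm.add_eq_max_of_ne h.ne', max_eq_left h.le]

lemma normX_add_self {P : (twinCurvePlus p q).toAffine.Point} (hP : 1 < normX P) :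
    normX (P + P) = 4 * normX P := by
  match P with
  | .zero => exact absurd hP (by simp [normX])
  | .some x y h =>
    have hE := (equation_iff x y).mp h.1
    replace hP : 1 < padicNorm 2 x := hP
    have hxp : padicNorm 2 (x + p) = padicNorm 2 x :=
      padicNorm_add_eq_left ((padicNorm.of_int p).trans_lt hP)
    have hxq : padicNorm 2 (x + q) = padicNorm 2 x :=
      padicNorm_add_eq_left ((padicNorm.of_int q).trans_lt hP)
    have hy2 : padicNorm 2 y ^ 2 = padicNorm 2 x ^ 3 := by
      rw [sq, ← padicNorm.mul, ← sq, hE, padicNorm.mul, padicNorm.mul, hxp, hxq]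
      ring
    have hx0 : 0 < padicNorm 2 x := one_pos.trans hP
    have hy : y ≠ 0 := by
      rintro rfl
      have : 0 < padicNorm 2 x ^ 3 := by positivity
      simp [← hy2] at this
    have hnum : padicNorm 2 (x ^ 2 - p * q) = padicNorm 2 x ^ 2 := by
      rw [sub_eq_add_neg, padicNorm_add_eq_left, sq, padicNorm.mul, sq]
      rw [padicNorm.neg, sq, padicNorm.mul x x]
      have := padicNorm.of_int (p := 2) (p * q)
      push_cast at this
      nlinarith
    obtain ⟨y', h', hadd⟩ := add_self_of_ne_zero h hy
    rw [hadd]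
    change padicNorm 2 _ = 4 * padicNorm 2 x
    have hy0 : padicNorm 2 y ≠ 0 := padicNorm.nonzero hy
    rw [sq, padicNorm.mul, padicNorm.div, padicNorm.mul, hnum, padicNorm_two_two]
    field_simp
    rw [hy2]
    ring

lemma not_isOfFinAddOrder_of_one_lt_normX {P : (twinCurvePlus p q).toAffine.Point}
    (hP : 1 < normX P) : ¬ IsOfFinAddOrder P := by
  intro hfin
  have : Finite (AddSubgroup.zmultiples P) := hfin.finite_zmultiples
  obtain ⟨Q, hQ⟩ := Finite.exists_max fun Q : AddSubgroup.zmultiples P ↦ normX Q.1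
  have h₁ := hQ ⟨P, AddSubgroup.mem_zmultiples P⟩
  have h₂ := hQ (Q + Q)
  have hQ1 : 1 < normX Q.1 := hP.trans_le h₁
  rw [AddSubgroup.coe_add, normX_add_self hQ1] at h₂
  linarith

lemma one_lt_padicNorm {β γ : ℚ} (h : γ * γ - β * β = 2) : 1 < padicNorm 2 (β * β) := by
  by_contra! hβ
  have hβ1 : padicNorm 2 β ≤ 1 := by
    rw [padicNorm.mul] at hβ
    nlinarith
  have hmul : padicNorm 2 (γ - β) * padicNorm 2 (γ + β) = 1 / 2 := by
    rw [← padicNorm.mul, ← padicNorm_two_two]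
    congr 1
    linear_combination h
  have hsub : padicNorm 2 ((γ + β) - (γ - β)) ≤ 1 / 2 := by
    rw [show (γ + β) - (γ - β) = 2 * β by ring, padicNorm.mul, padicNorm_two_two]
    linarith
  have hu := padicNorm.nonneg (p := 2) (γ - β)
  have hv := padicNorm.nonneg (p := 2) (γ + β)
  by_cases hne : padicNorm 2 (γ + β) = padicNorm 2 (γ - β)
  · rw [hne] at hmul
    exact absurd ⟨_, hmul.symm⟩ (by norm_num : ¬ IsSquare (1 / 2 : ℚ))
  · rw [sub_eq_add_neg, padicNorm.add_eq_max_of_ne (by rwa [padicNorm.neg]), padicNorm.neg] at hsub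
    have h₁ := (le_max_left _ _).trans hsub
    have h₂ := (le_max_right _ _).trans hsub
    nlinarith

lemma one_lt_normX_add_self (hpq : q = p + 2) {x y : ℚ}
    (h : (twinCurvePlus p q).toAffine.Nonsingular x y) (hy : y ≠ 0) :
    1 < normX (some x y h + some x y h) := by
  obtain ⟨y', h', hadd⟩ := add_self_of_ne_zero h hy
  obtain ⟨⟨β, hβ⟩, γ, hγ⟩ := isSquare_double ((equation_iff x y).mp h.1) hy
  rw [hadd]
  change 1 < padicNorm 2 _
  set X := ((x ^ 2 - p * q) / (2 * y)) ^ 2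
  have hlt : 1 < padicNorm 2 (β * β) := one_lt_padicNorm (γ := γ) (by
    rw [← hβ, ← hγ, hpq]
    push_cast
    ring)
  rw [← hβ] at hlt
  by_contra! hX
  exact hlt.not_ge (padicNorm.nonarchimedean.trans (max_le hX (padicNorm.of_int p)))

lemma add_self_eq_zero_of_isOfFinAddOrder (hpq : q = p + 2)
    (P : (twinCurvePlus p q).toAffine.Point) (hP : IsOfFinAddOrder P) : P + P = 0 := by
  match P with
  | .zero => exact add_zero 0
  | .some x y h =>
    rw [add_self_eq_zero_iff]
    by_contra hy
    exact not_isOfFinAddOrder_of_one_lt_normX (one_lt_normX_add_self hpq h hy) (hP.add hP)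

lemma ncard_two_torsion (hp : p ≠ 0) (hq : q ≠ 0) (hpq : p ≠ q) :
    {T : (twinCurvePlus p q).toAffine.Point | T + T = 0}.ncard = 4 := by
  have := isElliptic hp hq hpq
  have hp' : (p : ℚ) ≠ 0 := by exact_mod_cast hp
  have hq' : (q : ℚ) ≠ 0 := by exact_mod_cast hq
  have hpq' : (p : ℚ) ≠ q := by exact_mod_cast hpq
  have ns {e : ℚ} (he : e * (e + p) * (e + q) = 0) :
      (twinCurvePlus p q).toAffine.Nonsingular e 0 :=
    equation_iff_nonsingular.mp ((equation_iff e 0).mpr (by rw [he]; ring))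
  have h₁ := ns (e := 0) (by ring)
  have h₂ := ns (e := -p) (by ring)
  have h₃ := ns (e := -q) (by ring)
  have hset : {T : (twinCurvePlus p q).toAffine.Point | T + T = 0} =
      ({0, some _ _ h₁, some _ _ h₂, some _ _ h₃} :
        Set (twinCurvePlus p q).toAffine.Point) := by
    ext T
    match T with
    | .zero => exact iff_of_true (add_zero 0) (Or.inl rfl)
    | .some x y h =>
      simp only [Set.mem_ofPred_eq, add_self_eq_zero_iff, Set.mem_insert_iff, some_ne_zero,
        some.injEq, Set.mem_singleton_iff, false_or]
      refine ⟨fun hy ↦ ?_, by tauto⟩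
      have hE := (equation_iff x y).mp h.1
      simp only [hy, ne_eq, OfNat.ofNat_ne_zero, not_false_eq_true, zero_pow, zero_eq_mul,
        mul_eq_zero, add_eq_zero_iff_eq_neg] at hE
      tauto
  rw [hset, Set.ncard_insert_of_notMem, Set.ncard_insert_of_notMem, Set.ncard_pair] <;>
    simp [(some_ne_zero _).symm, hp', hq', hpq', eq_comm]

lemma isDoubleUpToTorsion_add (hp : Prime p) (hq : Prime q) (hp0 : 0 < p) (hpq : q = p + 2)
    (hmod : p % 8 = 3) (P Q : (twinCurvePlus p q).toAffine.Point)
    (hP : ¬ IsDoubleUpToTorsion P) (hQ : ¬ IsDoubleUpToTorsion Q) :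
    IsDoubleUpToTorsion (P + Q) := by
  have generator {P : (twinCurvePlus p q).toAffine.Point} (hP : ¬ IsDoubleUpToTorsion P) :
      ∃ T : (twinCurvePlus p q).toAffine.Point, T + T = 0 ∧ IsGeneratorPoint (P + T) := by
    obtain ⟨T, hT, ⟨R, hR⟩ | H⟩ := exists_double_or_generator hp hq hp0 hpq hmod P
    · exact absurd ⟨T, R, hT, hR⟩ hP
    · exact ⟨T, hT, H⟩
  obtain ⟨T, hT, hPT⟩ := generator hP
  obtain ⟨T', hT', hQT⟩ := generator hQ
  obtain ⟨R, hR⟩ := hPT.add hp0 hpq hQT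
  exact ⟨T + T', R, by rw [add_add_add_comm, hT, hT', add_zero], by rw [hR, add_add_add_comm]⟩

lemma exists_not_isOfFinAddOrder (hp : Prime p) (hq : Prime q) (hp0 : 0 < p) (hpq : q = p + 2)
    (hmod : p % 8 = 3) {a b c : ℤ} (hab : q = a ^ 2 + b ^ 2)
    (hc : (a + 1) ^ 2 + (b + 1) ^ 2 = c ^ 2) :
    ∃ P : (twinCurvePlus p q).toAffine.Point, ¬ IsOfFinAddOrder P := by
  have := isElliptic hp.ne_zero hq.ne_zero (by omega)
  have hc2 : c ^ 2 = q + 2 + 2 * (a + b) := by rw [← hc, hab]; ring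
  have hc0 : c ≠ 0 := by
    rintro rfl
    have ha : a = -1 := by nlinarith [sq_nonneg (a + 1), sq_nonneg (b + 1)]
    have hb : b = -1 := by nlinarith [sq_nonneg (a + 1), sq_nonneg (b + 1)]
    subst ha hb
    omega
  have h₁ : q + a + b ≠ 0 := by
    intro h0
    have : c ^ 2 = 2 - q := by linear_combination hc2 + 2 * h0
    have : 0 < c ^ 2 := by positivity
    omega
  have h₂ : a + b + 2 ≠ 0 := by
    intro h0
    refine hp.not_isSquare ⟨c, ?_⟩
    linear_combination -hpq - hc2 - 2 * h0
  have h₃ : b - a ≠ 0 := by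
    intro h0
    obtain rfl : b = a := by omega
    generalize b ^ 2 = s at hab
    omega
  have hcQ : (c : ℚ) ≠ 0 := by exact_mod_cast hc0
  have hy : ((q + a + b) * (a + b + 2) * (b - a) / c ^ 3 : ℚ) ≠ 0 :=
    div_ne_zero (by exact_mod_cast mul_ne_zero (mul_ne_zero h₁ h₂) h₃) (pow_ne_zero _ hcQ)
  have hc2Q : (c : ℚ) ^ 2 = q + 2 + 2 * (a + b) := by exact_mod_cast hc2
  have hpqQ : (q : ℚ) = p + 2 := by exact_mod_cast hpq
  have habQ : (q : ℚ) = a ^ 2 + b ^ 2 := by exact_mod_cast hab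
  have hxp : (-((q + a + b) ^ 2 / c ^ 2) + p : ℚ) = -((a + b + 2) ^ 2 / c ^ 2) := by
    field_simp
    rw [hc2Q, hpqQ]
    ring
  have hxq : (-((q + a + b) ^ 2 / c ^ 2) + q : ℚ) = (b - a) ^ 2 / c ^ 2 := by
    field_simp
    linear_combination q * hc2Q + 2 * habQ
  have hE : (twinCurvePlus p q).toAffine.Equation (-((q + a + b) ^ 2 / c ^ 2))
      ((q + a + b) * (a + b + 2) * (b - a) / c ^ 3) := by
    rw [equation_iff, hxp, hxq]
    field_simp
  refine ⟨some _ _ (equation_iff_nonsingular.mp hE), fun h ↦ hy ?_⟩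
  exact (add_self_eq_zero_iff _).mp (add_self_eq_zero_of_isOfFinAddOrder hpq _ h)

end twinCurvePlus

theorem stmt_3 (p q : ℤ) (hp : Prime p) (hq : Prime q) (htwin : q - p = 2)
    (hmod : p % 8 = 3)
    (hsum : ∃ a b c ε δ : ℤ, (ε = 1 ∨ ε = -1) ∧ (δ = 1 ∨ δ = -1) ∧
      q = a ^ 2 + b ^ 2 ∧ (a + ε) ^ 2 + (b + δ) ^ 2 = c ^ 2) :
    Nonempty (((twinCurvePlus p q).toAffine.Point) ≃+ (ZMod 2 × ZMod 2 × ℤ)) := by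
  obtain ⟨a, b, c, ε, δ, hε, hδ, hab, hc⟩ := hsum
  have hpq : q = p + 2 := by omega
  have hp0 : 0 < p := by
    have : 0 ≤ q := hab ▸ by positivity
    omega
  have hε2 : ε ^ 2 = 1 := by rcases hε with rfl | rfl <;> rfl
  have hδ2 : δ ^ 2 = 1 := by rcases hδ with rfl | rfl <;> rfl
  have hE := twinCurvePlus.isElliptic hp.ne_zero hq.ne_zero (by omega)
  have hcard := twinCurvePlus.ncard_two_torsion hp.ne_zero hq.ne_zero (by omega)
  have hadd := twinCurvePlus.isDoubleUpToTorsion_add hp hq hp0 hpq hmod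
  obtain ⟨C, hC⟩ :=
    WeierstrassCurve.Affine.Point.abs_naiveHeight_add_add_naiveHeight_sub_le
      (W := (twinCurvePlus p q).toAffine)
  have : AddGroup.FG (twinCurvePlus p q).toAffine.Point :=
    AddCommGroup.fg_of_descent' (AddCommGroup.finiteIndex_range_two
      (Set.finite_of_ncard_ne_zero (by rw [hcard]; norm_num)) hadd)
      WeierstrassCurve.Affine.Point.naiveHeight_nonneg hC
  refine AddCommGroup.nonempty_addEquiv_of_fg
    (twinCurvePlus.add_self_eq_zero_of_isOfFinAddOrder hpq) hcard
    (twinCurvePlus.exists_not_isOfFinAddOrder hp hq hp0 hpq hmod (a := ε * a) (b := δ * b)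
      (c := c) ?_ ?_) hadd
  · linear_combination hab - a ^ 2 * hε2 - b ^ 2 * hδ2
  · linear_combination hc + (a ^ 2 - 1) * hε2 + (b ^ 2 - 1) * hδ2
end

section
/- Let p and q be twin primes with q - p = 2 and suppose p ≡ 5 (mod 8). Then the simultaneous Diophantine system (I): X² - pY² = S², X² - qY² = -T² has no primary solution; that is, there are no integers X, Y, S, T with gcd(X, Y) = 1 and XY ≠ 0 satisfying both equations. -/
/-- A prime congruent to `3` modulo `4` which divides `x ^ 2 + y ^ 2` divides `y`. -/
lemma Nat.Prime.dvd_right_of_dvd_sq_add_sq {n : ℕ} (hn : n.Prime) (h3 : n % 4 = 3) {x y : ℤ}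
    (h : (n : ℤ) ∣ x ^ 2 + y ^ 2) : (n : ℤ) ∣ y := by
  have : Fact n.Prime := ⟨hn⟩
  by_contra hy
  rw [← ZMod.intCast_zmod_eq_zero_iff_dvd] at hy
  refine ZMod.mod_four_ne_three_of_sq_eq_neg_sq' (x := (x : ZMod n)) hy ?_ h3
  rw [← ZMod.intCast_zmod_eq_zero_iff_dvd] at h
  push_cast at h
  exact eq_neg_of_add_eq_zero_left h

/-- System (I) has no primary solution when `p ≡ 5 (mod 8)`. -/
theorem stmt_4 (p q : ℤ) (hp : Prime p) (hq : Prime q) (htwin : q - p = 2)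
    (hmod : p % 8 = 5) :
    ¬ ∃ X Y S T : ℤ, Int.gcd X Y = 1 ∧ X * Y ≠ 0 ∧
      X ^ 2 - p * Y ^ 2 = S ^ 2 ∧ X ^ 2 - q * Y ^ 2 = -T ^ 2 := by
  rintro ⟨X, Y, S, T, hXY, h0, -, h⟩
  have hX : X ≠ 0 := left_ne_zero_of_mul h0
  have hq0 : 0 ≤ q := by
    by_contra! hneg
    nlinarith [sq_nonneg T, sq_nonneg Y, pow_pos (abs_pos.2 hX) 2, sq_abs X]
  lift q to ℕ using hq0
  have hn : q.Prime := Nat.prime_iff_prime_int.2 hq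
  have h3 : q % 4 = 3 := by omega
  have hT : (q : ℤ) ∣ T :=
    hn.dvd_right_of_dvd_sq_add_sq h3 (x := X) ⟨Y ^ 2, by linarith⟩
  have hX' : (q : ℤ) ∣ X :=
    hn.dvd_right_of_dvd_sq_add_sq h3 (x := T) ⟨Y ^ 2, by linarith⟩
  have hY : (q : ℤ) ∣ Y := by
    obtain ⟨a, rfl⟩ := hX'
    obtain ⟨b, rfl⟩ := hT
    refine hq.dvd_of_dvd_pow (n := 2) ⟨a ^ 2 + b ^ 2, mul_left_cancel₀ hq.ne_zero ?_⟩
    linear_combination -h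
  exact hq.not_isUnit (isUnit_of_dvd_one (by simpa [hXY] using Int.dvd_coe_gcd hX' hY))
end

section
/- Let p and q be twin primes with q - p = 2 and suppose p ≡ 5 (mod 8). Then the simultaneous Diophantine system (II): X² - pY² = 2S², X² - qY² = -2T² has no primary solution; that is, there are no integers X, Y, S, T with gcd(X, Y) = 1 and XY ≠ 0 satisfying both equations. -/
/-- If `p ≡ 5 (mod 8)` is prime, then `2` is not a square modulo `p`, so a prime dividing
`a ^ 2 - 2 * b ^ 2` divides both `a` and `b`. -/
theorem dvd_and_dvd_of_dvd_sq_sub_two_mul_sq {p a b : ℤ} (hp : Prime p) (hmod : p % 8 = 5)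
    (h : p ∣ a ^ 2 - 2 * b ^ 2) : p ∣ a ∧ p ∣ b := by
  have : Fact p.natAbs.Prime := ⟨Int.prime_iff_natAbs_prime.mp hp⟩
  have hcast (x : ℤ) : (x : ZMod p.natAbs) = 0 ↔ p ∣ x := by
    rw [ZMod.intCast_zmod_eq_zero_iff_dvd, Int.natAbs_dvd]
  have hsq : (a : ZMod p.natAbs) ^ 2 = 2 * (b : ZMod p.natAbs) ^ 2 := by
    have := (hcast _).mpr h
    push_cast at this
    exact sub_eq_zero.mp this
  have hb : (b : ZMod p.natAbs) = 0 := by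
    by_contra hb
    have htwo : IsSquare (2 : ZMod p.natAbs) :=
      ⟨(a : ZMod p.natAbs) / b, by field_simp; exact hsq.symm⟩
    rw [ZMod.exists_sq_eq_two_iff (by omega)] at htwo
    omega
  have ha : (a : ZMod p.natAbs) = 0 := by simpa [hb] using hsq
  exact ⟨(hcast a).mp ha, (hcast b).mp hb⟩

/-- System (II) has no primary solution when `p ≡ 5 (mod 8)`. -/
theorem stmt_5 (p q : ℤ) (hp : Prime p) (hq : Prime q) (htwin : q - p = 2)
    (hmod : p % 8 = 5) :
    ¬ ∃ X Y S T : ℤ, Int.gcd X Y = 1 ∧ X * Y ≠ 0 ∧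
      X ^ 2 - p * Y ^ 2 = 2 * S ^ 2 ∧ X ^ 2 - q * Y ^ 2 = -(2 * T ^ 2) := by
  rintro ⟨X, Y, S, T, hgcd, -, h, -⟩
  obtain ⟨hX, hS⟩ : p ∣ X ∧ p ∣ S :=
    dvd_and_dvd_of_dvd_sq_sub_two_mul_sq hp hmod ⟨Y ^ 2, by linear_combination h⟩
  have hY : p ∣ Y := by
    obtain ⟨x, rfl⟩ := hX
    obtain ⟨s, rfl⟩ := hS
    refine hp.dvd_of_dvd_pow (n := 2) ⟨x ^ 2 - 2 * s ^ 2, mul_left_cancel₀ hp.ne_zero ?_⟩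
    linear_combination -h
  exact hp.not_isUnit ((Int.isCoprime_iff_gcd_eq_one.mpr hgcd).isUnit_of_dvd' hX hY)
end

section
/- Let p and q be twin primes with q - p = 2 and suppose p ≡ 5 (mod 8). Then the only integer solution of the simultaneous system X² - pY² = S², X² - qY² = -T² is X = Y = S = T = 0. -/
/-- The form `x ^ 2 + t ^ 2` represents `q * y ^ 2` with `q ≡ 3 (mod 4)` only for `y = 0`. -/
theorem eq_zero_of_sq_add_sq_eq_mul_sq {q : ℤ} (hq : q % 4 = 3) (x t y : ℤ)
    (h : x ^ 2 + t ^ 2 = q * y ^ 2) : y = 0 := by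
  induction hn : y.natAbs using Nat.strong_induction_on generalizing x t y with
  | _ n ih =>
    obtain ⟨k, rfl⟩ : ∃ k, q = 4 * k + 3 := ⟨q / 4, by omega⟩
    by_contra hy
    obtain ⟨a, rfl | rfl⟩ := Int.even_or_odd' x <;>
    obtain ⟨b, rfl | rfl⟩ := Int.even_or_odd' t <;>
    obtain ⟨c, rfl | rfl⟩ := Int.even_or_odd' y <;>
    ring_nf at h <;> try omega
    have hc : c = 0 := ih c.natAbs (by omega) a b c (by linarith) rfl
    exact hy (by simp [hc])

/-- The only integer solution of system (I) is the zero solution, when `p ≡ 5 (mod 8)`. -/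
theorem stmt_6 (p q : ℤ) (hp : Prime p) (hq : Prime q) (htwin : q - p = 2)
    (hmod : p % 8 = 5) (X Y S T : ℤ)
    (h1 : X ^ 2 - p * Y ^ 2 = S ^ 2) (h2 : X ^ 2 - q * Y ^ 2 = -T ^ 2) :
    X = 0 ∧ Y = 0 ∧ S = 0 ∧ T = 0 := by
  have hY : Y = 0 :=
    eq_zero_of_sq_add_sq_eq_mul_sq (q := q) (by omega) X T Y (by linarith)
  subst hY
  have hX : X = 0 := pow_eq_zero_iff two_ne_zero |>.mp (by nlinarith [sq_nonneg X, sq_nonneg T])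
  subst hX
  exact ⟨rfl, rfl, pow_eq_zero_iff two_ne_zero |>.mp (by linarith),
    pow_eq_zero_iff two_ne_zero |>.mp (by linarith)⟩
end

section
/- Let p and q be twin primes with q - p = 2 and suppose p ≡ 5 (mod 8). Then the only integer solution of the simultaneous system X² - pY² = 2S², X² - qY² = -2T² is X = Y = S = T = 0. -/
lemma even_of_sq_sub_mul_sq_eq_two_mul_sq {p X Y S : ℤ} (hmod : p % 8 = 5)
    (h : X ^ 2 - p * Y ^ 2 = 2 * S ^ 2) : Even X ∧ Even Y ∧ Even S := by
  obtain ⟨k, rfl⟩ : ∃ k, p = 8 * k + 5 := ⟨p / 8, by omega⟩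
  rcases Int.even_or_odd' X with ⟨x, rfl | rfl⟩ <;>
  rcases Int.even_or_odd' Y with ⟨y, rfl | rfl⟩ <;>
  rcases Int.even_or_odd' S with ⟨s, rfl | rfl⟩
  · simp
  all_goals
    exfalso
    obtain ⟨a, ha⟩ := (Int.even_mul_succ_self x)
    obtain ⟨b, hb⟩ := (Int.even_mul_succ_self y)
    ring_nf at h ha hb
    generalize k * y ^ 2 = u at *
    generalize k * y = v at *
    omega

lemma eq_zero_of_sq_sub_mul_sq_eq_two_mul_sq {p : ℤ} (hmod : p % 8 = 5) (X Y S : ℤ)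
    (h : X ^ 2 - p * Y ^ 2 = 2 * S ^ 2) : X = 0 ∧ Y = 0 ∧ S = 0 := by
  induction hn : X.natAbs + Y.natAbs + S.natAbs using Nat.strong_induction_on
    generalizing X Y S with
  | _ n ih =>
    obtain ⟨⟨x, rfl⟩, ⟨y, rfl⟩, ⟨s, rfl⟩⟩ := even_of_sq_sub_mul_sq_eq_two_mul_sq hmod h
    by_cases hzero : n = 0
    · omega
    · have := ih (x.natAbs + y.natAbs + s.natAbs) (by omega) x y s (by linarith) rfl
      omega

/-- The only integer solution of system (II) is the zero solution, when `p ≡ 5 (mod 8)`. -/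
theorem stmt_7 (p q : ℤ) (hp : Prime p) (hq : Prime q) (htwin : q - p = 2)
    (hmod : p % 8 = 5) (X Y S T : ℤ)
    (h1 : X ^ 2 - p * Y ^ 2 = 2 * S ^ 2) (h2 : X ^ 2 - q * Y ^ 2 = -(2 * T ^ 2)) :
    X = 0 ∧ Y = 0 ∧ S = 0 ∧ T = 0 := by
  obtain ⟨rfl, rfl, rfl⟩ := eq_zero_of_sq_sub_mul_sq_eq_two_mul_sq hmod X Y S h1
  refine ⟨rfl, rfl, rfl, ?_⟩
  simpa using h2
end

section
/- Let p and q be twin primes with q - p = 2 and suppose p ≡ 5 (mod 8). Let σ ∈ {+1, -1}. Then the simultaneous Pellian equations (III): x² - py² = σ, z² - qy² = σ have no nontrivial integer solution, i.e., no integer solution (x, y, z) with y ≠ 0. -/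
/-- Coprime integers whose product is an even power are, up to a common sign, powers. -/
theorem exists_sign_mul_pow_of_isCoprime {a b c : ℤ} {k : ℕ} (hk : Even k) (hk0 : k ≠ 0)
    (hc : c ≠ 0) (hab : IsCoprime a b) (h : a * b = c ^ k) :
    ∃ ε r s : ℤ, (ε = 1 ∨ ε = -1) ∧ a = ε * r ^ k ∧ b = ε * s ^ k ∧ (r * s) ^ 2 = c ^ 2 := by
  obtain ⟨r, hr⟩ := exists_associated_pow_of_mul_eq_pow' hab h
  obtain ⟨s, hs⟩ := exists_associated_pow_of_mul_eq_pow' hab.symm ((mul_comm b a).trans h)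
  rw [Int.associated_iff] at hr hs
  have hcpos : 0 < c ^ k := hk.pow_pos hc
  have key (hrs : r ^ k * s ^ k = c ^ k) : (r * s) ^ 2 = c ^ 2 := by
    rw [← mul_pow, pow_eq_pow_iff_of_ne_zero hk0] at hrs
    rcases hrs with hrs | ⟨hrs, -⟩ <;> rw [hrs]
    ring
  have hrk : 0 ≤ r ^ k := hk.pow_nonneg r
  have hsk : 0 ≤ s ^ k := hk.pow_nonneg s
  rcases hr with hr | hr <;> rcases hs with hs | hs
  · exact ⟨1, r, s, .inl rfl, by linarith, by linarith, key (by rw [hr, hs, h])⟩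
  · exfalso; nlinarith
  · exfalso; nlinarith
  · exact ⟨-1, r, s, .inr rfl, by linarith, by linarith, key (by rw [hr, hs, ← h]; ring)⟩

/-- Neither `2` nor `-2` is a square modulo a prime `p ≡ 5 (mod 8)`. -/
theorem dvd_of_dvd_sq_sub_two_mul_sq {p : ℤ} (hp : Prime p) (hp0 : 0 < p) (hmod : p % 8 = 5)
    {δ b s : ℤ} (hδ : δ = 1 ∨ δ = -1) (h : p ∣ b ^ 2 - δ * 2 * s ^ 2) : p ∣ s := by
  lift p to ℕ using hp0.le
  have hp' : Nat.Prime p := Nat.prime_iff_prime_int.mpr hp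
  have : Fact p.Prime := ⟨hp'⟩
  have hp2 : p ≠ 2 := by omega
  by_contra hs
  rw [← ZMod.intCast_zmod_eq_zero_iff_dvd] at hs
  have hz := (ZMod.intCast_zmod_eq_zero_iff_dvd _ p).mpr h
  push_cast at hz
  have hsq : IsSquare ((δ : ZMod p) * 2) := by
    refine ⟨b / s, ?_⟩
    field_simp
    linear_combination -hz
  rcases hδ with rfl | rfl
  · have := (ZMod.exists_sq_eq_two_iff hp2).mp (by simpa using hsq)
    omega
  · have := (ZMod.exists_sq_eq_neg_two_iff hp2).mp (by simpa using hsq)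
    omega

/-- The splitting of the quartic in which `p` and `p + 2` divide different factors. -/
theorem false_of_separate_factors {p m n a b : ℤ} (hp : Prime p) (hp0 : 0 < p)
    (hmod : p % 8 = 5) (hm : Odd m) (hn : n ≠ 0) (hmn : IsCoprime m n) (hab : IsCoprime a b)
    (hprod : a * b = n ^ 4) (hsum : p * a + (p + 2) * b = m ^ 2 - 2 * (p + 1) * n ^ 2) :
    False := by
  obtain ⟨ε, r, s, hε, rfl, rfl, hrs⟩ :=
    exists_sign_mul_pow_of_isCoprime (by decide) (by decide) hn hab hprod
  have hε2 : ε ^ 2 = 1 := by rcases hε with rfl | rfl <;> rfl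
  have hrs' : IsCoprime r s :=
    (IsCoprime.pow_iff four_pos four_pos).mp (hab.of_mul_left_right.of_mul_right_right)
  have hfac : (r ^ 2 + ε * s ^ 2) * (ε * (p * r ^ 2 + ε * (p + 2) * s ^ 2)) = m ^ 2 := by
    linear_combination hsum + 2 * (p + 1) * hrs +
      (r ^ 2 * s ^ 2 * (2 * p + 2) + ε * s ^ 4 * (p + 2)) * hε2
  have hεu : IsUnit ε := by rcases hε with rfl | rfl <;> simp
  have hodd : Odd (r ^ 2 + ε * s ^ 2) :=
    (Int.odd_mul.mp (hfac ▸ hm.pow)).1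
  have h2 : IsCoprime (r ^ 2 + ε * s ^ 2) 2 := by
    obtain ⟨c, hc⟩ := hodd
    exact ⟨1, -c, by linear_combination hc⟩
  have hs : IsCoprime (r ^ 2 + ε * s ^ 2) (s ^ 2) :=
    (IsCoprime.add_mul_right_left_iff).mpr hrs'.pow
  have hcop : IsCoprime (r ^ 2 + ε * s ^ 2) (ε * (p * r ^ 2 + ε * (p + 2) * s ^ 2)) := by
    refine (isCoprime_mul_unit_left_right hεu _ _).mpr ?_
    have := ((isCoprime_mul_unit_left_right hεu _ _).mpr (h2.mul_right hs)).add_mul_left_right p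
    rwa [show ε * (2 * s ^ 2) + (r ^ 2 + ε * s ^ 2) * p = p * r ^ 2 + ε * (p + 2) * s ^ 2 by ring]
      at this
  obtain ⟨t, ht⟩ := Int.sq_of_isCoprime hcop.symm ((mul_comm _ _).trans hfac)
  have hps : p ∣ s := by
    rcases ht with ht | ht
    · refine dvd_of_dvd_sq_sub_two_mul_sq hp hp0 hmod (b := t) (.inl rfl) ⟨ε * r ^ 2 + s ^ 2, ?_⟩
      linear_combination -ht + (p + 2) * s ^ 2 * hε2
    · refine dvd_of_dvd_sq_sub_two_mul_sq hp hp0 hmod (b := t) (.inr rfl)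
        ⟨-(ε * r ^ 2 + s ^ 2), ?_⟩
      linear_combination ht - (p + 2) * s ^ 2 * hε2
  have hpn : p ∣ n := hp.dvd_of_dvd_pow (n := 2) (hrs ▸ dvd_pow (hps.mul_left r) two_ne_zero)
  have hpm : p ∣ m := by
    refine hp.dvd_of_dvd_pow (n := 2) ?_
    rw [← hfac]
    obtain ⟨c, rfl⟩ := hps
    exact Dvd.dvd.mul_left ⟨ε * r ^ 2 + ε ^ 2 * (p + 2) * p * c ^ 2, by ring⟩ _
  exact hp.not_isUnit (hmn.isUnit_of_dvd' hpm hpn)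

/-- Coprimality may be checked on the sum and the product. -/
theorem isCoprime_of_isCoprime_add_mul {a b : ℤ} (h : IsCoprime (a + b) (a * b)) :
    IsCoprime a b := by
  obtain ⟨u, v, huv⟩ := h.of_mul_right_left
  exact ⟨u + v, u, by linear_combination huv⟩

/-- Modulo `8`, the sign is positive, `r` is odd and `s` is even. -/
theorem sign_and_parity_of_quartic {p m r s ε : ℤ} (hmod : p % 8 = 5) (hm : Odd m)
    (hε : ε = 1 ∨ ε = -1)
    (h : ε * r ^ 4 + p * (p + 2) * (ε * s ^ 4) + 2 * (p + 1) * (r ^ 2 * s ^ 2) = m ^ 2) :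
    ε = 1 ∧ Odd r ∧ Even s := by
  obtain ⟨c, rfl⟩ := hm
  obtain ⟨d, hd⟩ : ∃ d, p = 5 + 8 * d := ⟨p / 8, by omega⟩
  have h8 : (8 : ZMod 8) = 0 := rfl
  have hz := congrArg (Int.cast : ℤ → ZMod 8) h
  have hp : (p : ZMod 8) = 5 := by rw [hd]; push_cast; rw [h8]; ring
  push_cast [hp] at hz
  have hpos : ∀ c r s : ZMod 8, 1 * r ^ 4 + 5 * (5 + 2) * (1 * s ^ 4) +
      2 * (5 + 1) * (r ^ 2 * s ^ 2) = (2 * c + 1) ^ 2 → 4 * (r - 1) = 0 ∧ 4 * s = 0 := by decide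
  have hneg : ∀ c r s : ZMod 8, -1 * r ^ 4 + 5 * (5 + 2) * (-1 * s ^ 4) +
      2 * (5 + 1) * (r ^ 2 * s ^ 2) ≠ (2 * c + 1) ^ 2 := by decide
  rcases hε with rfl | rfl
  · obtain ⟨h1, h2⟩ := hpos c r s (by simpa using hz)
    have h1' : ((4 * (r - 1) : ℤ) : ZMod 8) = 0 := by exact_mod_cast h1
    have h2' : ((4 * s : ℤ) : ZMod 8) = 0 := by exact_mod_cast h2
    rw [ZMod.intCast_zmod_eq_zero_iff_dvd] at h1' h2'
    refine ⟨rfl, ?_, ?_⟩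
    · rw [Int.odd_iff]; omega
    · rw [Int.even_iff]; omega
  · exact absurd (by simpa using hz) (hneg c r s)

/-- Primitive solutions of `m ^ 2 + 16 t ^ 4 = T ^ 2` with `m` odd. -/
theorem exists_sq_add_four_mul_pow {m t T : ℤ} (hm : Odd m) (ht : t ≠ 0) (hT : 0 < T)
    (hTt : IsCoprime T t) (h : m ^ 2 + 16 * t ^ 4 = T ^ 2) :
    ∃ g h : ℤ, Odd g ∧ IsCoprime g h ∧ (g * h) ^ 2 = t ^ 2 ∧ T = g ^ 4 + 4 * h ^ 4 := by
  have hTodd : Odd T := by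
    have : Odd (T ^ 2) := by
      rw [← h]
      exact hm.pow.add_even ⟨8 * t ^ 4, by ring⟩
    exact (Int.odd_pow' two_ne_zero).mp this
  have main (a b : ℤ) (hsum : a + 4 * b = T) (hprod : a * b = t ^ 4) :
      ∃ g h : ℤ, Odd g ∧ IsCoprime g h ∧ (g * h) ^ 2 = t ^ 2 ∧ T = g ^ 4 + 4 * h ^ 4 := by
    have ha : Odd a := by
      rw [← hsum, Int.odd_add] at hTodd
      exact hTodd.mpr ⟨2 * b, by ring⟩
    have hab : IsCoprime a b := by
      have h2 : IsCoprime T 4 := by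
        obtain ⟨c, hc⟩ := hTodd
        exact ⟨T, -(c ^ 2 + c), by rw [hc]; ring⟩
      have : IsCoprime a (4 * b) := isCoprime_of_isCoprime_add_mul (by
        rw [hsum, show a * (4 * b) = 4 * t ^ 4 by rw [← hprod]; ring]
        exact h2.mul_right hTt.pow_right)
      exact this.of_mul_right_right
    obtain ⟨ε, g, h, hε, rfl, rfl, hgh⟩ :=
      exists_sign_mul_pow_of_isCoprime (by decide) (by decide) ht hab hprod
    have hε1 : ε = 1 := by
      rcases hε with rfl | rfl
      · rfl
      · nlinarith [sq_nonneg (g ^ 2), sq_nonneg (h ^ 2)]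
    subst hε1
    refine ⟨g, h, ?_, ?_, hgh, by linarith⟩
    · exact (Int.odd_pow' (by decide : (4 : ℕ) ≠ 0)).mp (by simpa using ha)
    · exact (IsCoprime.pow_iff four_pos four_pos).mp (by simpa using hab)
  obtain ⟨c, rfl⟩ := hm
  obtain ⟨d, rfl⟩ := hTodd
  have hcd : (d - c) * (d + c + 1) = 4 * t ^ 4 := by linarith
  rcases Int.even_or_odd (d - c) with he | ho
  · have h4 : IsCoprime (4 : ℤ) (d + c + 1) := by
      obtain ⟨e, he⟩ := he
      exact ⟨-((e + c) ^ 2 + (e + c)), d + c + 1, by rw [show d = e + e + c by linarith]; ring⟩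
    obtain ⟨b, hb⟩ := h4.dvd_of_dvd_mul_right (Dvd.intro _ hcd.symm)
    exact main (d + c + 1) b (by linarith) (by rw [hb] at hcd; linarith)
  · have h4 : IsCoprime (4 : ℤ) (d - c) := by
      obtain ⟨e, he⟩ := ho
      exact ⟨-(e ^ 2 + e), d - c, by rw [he]; ring⟩
    obtain ⟨b, hb⟩ := h4.dvd_of_dvd_mul_left (Dvd.intro _ hcd.symm)
    exact main (d - c) b (by linarith) (by rw [hb] at hcd; linarith)

/-- The splitting of the quartic in which `p` and `p + 2` divide the same factor yields a
smaller solution. -/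
theorem exists_descent_of_common_factor {p m n a b : ℤ} (hp0 : 0 < p)
    (hmod : p % 8 = 5) (hm : Odd m) (hn : n ≠ 0) (hab : IsCoprime a b)
    (hprod : a * b = n ^ 4) (hsum : a + p * (p + 2) * b = m ^ 2 - 2 * (p + 1) * n ^ 2) :
    ∃ g h r : ℤ, Odd g ∧ h ≠ 0 ∧ IsCoprime g h ∧ h ^ 2 < n ^ 2 ∧
      r ^ 2 = g ^ 4 - 4 * (p + 1) * g ^ 2 * h ^ 2 + 4 * h ^ 4 := by
  obtain ⟨ε, r, s, hε, rfl, rfl, hrs⟩ :=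
    exists_sign_mul_pow_of_isCoprime (by decide) (by decide) hn hab hprod
  obtain ⟨rfl, hr, t, rfl⟩ := sign_and_parity_of_quartic (r := r) (s := s) hmod hm hε
    (by linear_combination hsum + 2 * (p + 1) * hrs)
  have hrt : IsCoprime r t := by
    have : IsCoprime (r ^ 4) ((t + t) ^ 4) := by simpa using hab
    rw [IsCoprime.pow_iff four_pos four_pos, ← two_mul] at this
    exact this.of_mul_right_right
  have ht : t ≠ 0 := by
    rintro rfl; simp at hrs; exact hn (pow_eq_zero_iff two_ne_zero |>.mp hrs.symm)
  have hr0 : r ≠ 0 := by rintro rfl; simp at hr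
  have hr2 : 0 < r ^ 2 := by positivity
  have ht2 : 0 < t ^ 2 := by positivity
  have hTt : IsCoprime (r ^ 2 + 4 * (p + 1) * t ^ 2) t := by
    have := (hrt.pow_left (m := 2)).add_mul_left_left (4 * (p + 1) * t)
    rwa [show r ^ 2 + t * (4 * (p + 1) * t) = r ^ 2 + 4 * (p + 1) * t ^ 2 by ring] at this
  obtain ⟨g, h, hg, hgh, hght, hT⟩ := exists_sq_add_four_mul_pow
    hm ht (by positivity) hTt (by linear_combination -hsum - 2 * (p + 1) * hrs)
  have hh : h ≠ 0 := by
    rintro rfl; simp at hght; exact ht (pow_eq_zero_iff two_ne_zero |>.mp hght.symm)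
  have hg0 : g ≠ 0 := by rintro rfl; simp at hg
  have hg2 : 0 < g ^ 2 := by positivity
  have hh2 : 0 < h ^ 2 := by positivity
  refine ⟨g, h, r, hg, hh, hgh, ?_, by linear_combination hT + 4 * (p + 1) * hght⟩
  have : h ^ 2 ≤ t ^ 2 := by rw [← hght, mul_pow]; nlinarith
  have : t ^ 2 ≤ r ^ 2 * t ^ 2 := by nlinarith
  nlinarith

/-- Infinite descent on `R ^ 2 = m ^ 4 - 4 (p + 1) m ^ 2 n ^ 2 + 4 n ^ 4`. -/
theorem quartic_ne_sq {p : ℤ} (hp : Prime p) (hq : Prime (p + 2)) (hp0 : 0 < p)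
    (hmod : p % 8 = 5) {m n : ℤ} (R : ℤ) (hm : Odd m) (hn : n ≠ 0) (hmn : IsCoprime m n) :
    R ^ 2 ≠ m ^ 4 - 4 * (p + 1) * m ^ 2 * n ^ 2 + 4 * n ^ 4 := by
  induction hN : n.natAbs using Nat.strong_induction_on generalizing m n R with
  | _ N ih =>
  subst hN
  intro hR
  have hRodd : Odd R := by
    have : Odd (R ^ 2) := by
      rw [hR, show m ^ 4 - 4 * (p + 1) * m ^ 2 * n ^ 2 + 4 * n ^ 4 =
        m ^ 4 + 2 * (2 * n ^ 4 - 2 * (p + 1) * m ^ 2 * n ^ 2) by ring]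
      exact hm.pow.add_even (even_two_mul _)
    exact (Int.odd_pow' two_ne_zero).mp this
  obtain ⟨a, ha⟩ : Even (m ^ 2 - 2 * (p + 1) * n ^ 2 - R) := by
    refine Odd.sub_odd ?_ hRodd
    exact hm.pow.sub_even ⟨(p + 1) * n ^ 2, by ring⟩
  obtain ⟨b, hsum⟩ : ∃ b, a + b = m ^ 2 - 2 * (p + 1) * n ^ 2 :=
    ⟨m ^ 2 - 2 * (p + 1) * n ^ 2 - a, by ring⟩
  have hprod : a * b = p * (p + 2) * n ^ 4 := by
    have hRe : R = b - a := by linarith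
    rw [hRe] at hR
    have : (a + b) ^ 2 = (m ^ 2 - 2 * (p + 1) * n ^ 2) ^ 2 := by rw [hsum]
    linarith
  have hpq : IsCoprime p (p + 2) := by
    obtain ⟨j, rfl⟩ : Odd p := by rw [Int.odd_iff]; omega
    exact ⟨j + 1, -j, by ring⟩
  have hab : IsCoprime a b := by
    refine isCoprime_of_prime_dvd ?_ ?_
    · rintro ⟨ha0, -⟩
      rw [ha0, zero_mul] at hprod
      exact mul_ne_zero (mul_ne_zero hp.ne_zero hq.ne_zero) (pow_ne_zero 4 hn) hprod.symm
    · intro l hl hla hlb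
      have hln : ¬ l ∣ n := by
        intro hln
        have hlm : l ∣ m := by
          refine hl.dvd_of_dvd_pow (n := 2) ?_
          have : m ^ 2 = a + b + 2 * (p + 1) * n ^ 2 := by linarith
          rw [this]
          exact (hla.add hlb).add ((dvd_pow hln two_ne_zero).mul_left _)
        exact hl.not_isUnit (hmn.isUnit_of_dvd' hlm hln)
      have hsf : Squarefree (p * (p + 2)) :=
        squarefree_mul_iff.mpr ⟨hpq.isRelPrime, hp.squarefree, hq.squarefree⟩
      have hcop : IsCoprime (l * l) (n ^ 4) := by
        have := (hl.irreducible.coprime_iff_not_dvd).mpr hln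
        exact (this.mul_left this).pow_right
      exact hl.not_isUnit
        (hsf l (hcop.dvd_of_dvd_mul_right (hprod ▸ mul_dvd_mul hla hlb)))
  have same {a b : ℤ} (hab : IsCoprime a b) (hsum : a + b = m ^ 2 - 2 * (p + 1) * n ^ 2)
      (hprod : a * b = p * (p + 2) * n ^ 4) (hpb : p ∣ b) (hqb : p + 2 ∣ b) : False := by
    obtain ⟨c, rfl⟩ := hpq.mul_dvd hpb hqb
    obtain ⟨g, h, r, hg, hh, hgh, hlt, hr⟩ := exists_descent_of_common_factor hp0 hmod hm hn
      hab.of_mul_right_right (mul_left_cancel₀ (mul_ne_zero hp.ne_zero hq.ne_zero)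
        (by linear_combination hprod)) hsum
    exact ih _ (Int.natAbs_lt_iff_sq_lt.mpr hlt) r hg hh hgh rfl hr
  have diff {a b : ℤ} (hab : IsCoprime a b) (hsum : a + b = m ^ 2 - 2 * (p + 1) * n ^ 2)
      (hprod : a * b = p * (p + 2) * n ^ 4) (hpa : p ∣ a) (hqb : p + 2 ∣ b) : False := by
    obtain ⟨c, rfl⟩ := hpa
    obtain ⟨d, rfl⟩ := hqb
    exact false_of_separate_factors hp hp0 hmod hm hn hmn
      hab.of_mul_left_right.of_mul_right_right
      (mul_left_cancel₀ (mul_ne_zero hp.ne_zero hq.ne_zero) (by linear_combination hprod)) hsum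
  have hprod' := (mul_comm b a).trans hprod
  have hsum' := (add_comm b a).trans hsum
  rcases hp.dvd_or_dvd (⟨_, hprod.trans (mul_assoc _ _ _)⟩ : p ∣ a * b) with h1 | h1 <;>
  rcases hq.dvd_or_dvd
    (⟨p * n ^ 4, by linear_combination hprod⟩ : p + 2 ∣ a * b) with h2 | h2
  · exact same hab.symm hsum' hprod' h1 h2
  · exact diff hab hsum hprod h1 h2
  · exact diff hab.symm hsum' hprod' h1 h2
  · exact same hab hsum hprod h1 h2

/-- A common solution of both Pell equations is parametrized by a solution of the quartic. -/
theorem exists_quartic_of_pell {p x y z : ℤ} (hmod : p % 8 = 5) (hy : y ≠ 0)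
    (hx : x ^ 2 - p * y ^ 2 = 1) (hz : z ^ 2 - (p + 2) * y ^ 2 = 1) :
    ∃ m n : ℤ, Odd m ∧ n ≠ 0 ∧ IsCoprime m n ∧
      1 ^ 2 = m ^ 4 - 4 * (p + 1) * m ^ 2 * n ^ 2 + 4 * n ^ 4 := by
  obtain ⟨w, rfl⟩ : Even y := by
    rw [← Int.not_odd_iff_even]
    rintro ⟨c, rfl⟩
    obtain ⟨d, rfl⟩ : ∃ d, p = 5 + 8 * d := ⟨p / 8, by omega⟩
    have h8 : (8 : ZMod 8) = 0 := rfl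
    have hx8 := congrArg (Int.cast : ℤ → ZMod 8) hx
    push_cast [h8] at hx8
    have : ∀ x c : ZMod 8, x ^ 2 - (5 + 0) * (2 * c + 1) ^ 2 ≠ 1 := by decide
    exact this x c (by simpa using hx8)
  have hw : w ≠ 0 := by rintro rfl; simp at hy
  have hxo : Odd x := by
    have : Odd (x ^ 2) := ⟨2 * p * w ^ 2, by linear_combination hx⟩
    exact (Int.odd_pow' two_ne_zero).mp this
  have hzo : Odd z := by
    have : Odd (z ^ 2) := ⟨2 * (p + 2) * w ^ 2, by linear_combination hz⟩
    exact (Int.odd_pow' two_ne_zero).mp this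
  have main (a b : ℤ) (hs : a + 2 * b = z) (hd : (a - 2 * b) ^ 2 = x ^ 2) :
      ∃ m n : ℤ, Odd m ∧ n ≠ 0 ∧ IsCoprime m n ∧
        1 ^ 2 = m ^ 4 - 4 * (p + 1) * m ^ 2 * n ^ 2 + 4 * n ^ 4 := by
    have hprod : a * b = w ^ 2 := by
      rw [← hs] at hz
      linarith
    have hab : IsCoprime a b := by
      have h1 : IsCoprime a (2 * b) := by
        refine isCoprime_of_isCoprime_add_mul ?_
        rw [hs]
        exact ⟨z, -2 * (p + 2), by linear_combination hz - 4 * (p + 2) * hprod⟩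
      exact h1.of_mul_right_right
    have hao : Odd a := by
      rw [← hs, Int.odd_add] at hzo
      exact hzo.mpr (even_two_mul b)
    obtain ⟨ε, m, n, hε, rfl, rfl, hmn⟩ :=
      exists_sign_mul_pow_of_isCoprime even_two two_ne_zero hw hab hprod
    have hε2 : ε ^ 2 = 1 := by rcases hε with rfl | rfl <;> rfl
    refine ⟨m, n, ?_, ?_, ?_, ?_⟩
    · exact (Int.odd_pow' two_ne_zero).mp (Int.odd_mul.mp hao).2
    · rintro rfl; simp at hmn; exact hw (pow_eq_zero_iff two_ne_zero |>.mp hmn.symm)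
    · exact (IsCoprime.pow_iff two_pos two_pos).mp (hab.of_mul_left_right.of_mul_right_right)
    · linear_combination -hx - hd + (m ^ 2 - 2 * n ^ 2) ^ 2 * hε2 + 4 * p * hmn
  obtain ⟨c, rfl⟩ := hxo
  obtain ⟨d, rfl⟩ := hzo
  rcases Int.even_or_odd' (d - c) with ⟨b, hb | hb⟩
  · exact main (d + c + 1) b (by linarith) (by rw [show d = c + 2 * b by linarith]; ring)
  · obtain ⟨e, he⟩ : Even (d + c + 1) := by
      exact ⟨c + b + 1, by linarith⟩
    exact main (d - c) e (by linarith) (by rw [show d = e + e - c - 1 by linarith]; ring)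

/-- The simultaneous Pellian equations (III) have no nontrivial integer solution
when `p ≡ 5 (mod 8)`. -/
theorem stmt_10 (p q : ℤ) (hp : Prime p) (hq : Prime q) (htwin : q - p = 2)
    (hmod : p % 8 = 5) (σ : ℤ) (hσ : σ = 1 ∨ σ = -1) :
    ¬ ∃ x y z : ℤ, y ≠ 0 ∧ x ^ 2 - p * y ^ 2 = σ ∧ z ^ 2 - q * y ^ 2 = σ := by
  obtain rfl : q = p + 2 := by linarith
  rintro ⟨x, y, z, hy, hx, hz⟩
  have hy2 : 0 < y ^ 2 := by positivity
  rcases hσ with rfl | rfl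
  · have hp0 : 0 < p := by
      by_contra hp0
      have : p ≤ -2 := by omega
      nlinarith [sq_nonneg x]
    obtain ⟨m, n, hm, hn, hmn, h⟩ := exists_quartic_of_pell hmod hy hx hz
    exact quartic_ne_sq hp hq hp0 hmod 1 hm hn hmn h
  · obtain ⟨d, rfl⟩ : ∃ d, p = 5 + 4 * d := ⟨p / 4 - 1, by omega⟩
    have h4 : (4 : ZMod 4) = 0 := rfl
    have hz4 := congrArg (Int.cast : ℤ → ZMod 4) hz
    push_cast [h4] at hz4
    have : ∀ z y : ZMod 4, z ^ 2 - (5 + 0 + 2) * y ^ 2 ≠ -1 := by decide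
    exact this z y (by simpa using hz4)
end

section
/- Let p and q be twin primes with q - p = 2, let σ ∈ {+1, -1}, and let E_σ be the elliptic curve y² = x(x + σp)(x + σq) over ℚ. If (a, b, c) is a nontrivial integer solution of the simultaneous Pellian equations (III): a² - pb² = σ, c² - qb² = σ with b ≠ 0, then the point (1/b², ac/b³) is a ℚ-rational point of E_σ; that is, the rational numbers x₀ = 1/b² and y₀ = ac/b³ satisfy y₀² = x₀(x₀ + σp)(x₀ + σq). -/
/-- A nontrivial integer solution of the simultaneous Pellian equations (III) gives the
rational point `(1/b², ac/b³)` on the elliptic curve `E_σ : y² = x (x + σp) (x + σq)`. -/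
theorem stmt_14 (p q : ℤ) (hp : Prime p) (hq : Prime q) (htwin : q - p = 2)
    (σ : ℤ) (hσ : σ = 1 ∨ σ = -1) (a b c : ℤ) (hb : b ≠ 0)
    (h1 : a ^ 2 - p * b ^ 2 = σ) (h2 : c ^ 2 - q * b ^ 2 = σ) :
    let x₀ : ℚ := 1 / (b : ℚ) ^ 2
    let y₀ : ℚ := (a : ℚ) * (c : ℚ) / (b : ℚ) ^ 3
    y₀ ^ 2 = x₀ * (x₀ + (σ : ℚ) * (p : ℚ)) * (x₀ + (σ : ℚ) * (q : ℚ)) := by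
  intro x₀ y₀
  have hb' : (b : ℚ) ≠ 0 := by exact_mod_cast hb
  have hσ' : (σ : ℚ) ^ 2 = 1 := by rcases hσ with rfl | rfl <;> norm_num
  have ha : (a : ℚ) ^ 2 = σ + p * (b : ℚ) ^ 2 := by exact_mod_cast eq_add_of_sub_eq h1
  have hc : (c : ℚ) ^ 2 = σ + q * (b : ℚ) ^ 2 := by exact_mod_cast eq_add_of_sub_eq h2
  have key : ∀ r : ℚ, 1 / (b : ℚ) ^ 2 + σ * r = σ * (σ + r * (b : ℚ) ^ 2) / (b : ℚ) ^ 2 := by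
    intro r
    field_simp
    linear_combination -hσ'
  simp only [x₀, y₀]
  rw [key, key, ← ha, ← hc]
  field_simp
  linear_combination -(a : ℚ) ^ 2 * (c : ℚ) ^ 2 * hσ'
end
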